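/- arXiv:2510.11252 — 4 statements merged into one kernel-verified Lean document; each statement's English description precedes it below -/
import Mathlib

section
/- Let N ≥ 10^{100000} be a real number and let 1 ≤ k ≤ 6 be an integer. Then for every real x ≥ 10^5, writing g_{k,N}(x) = (−1)^k · f_N^{(k)}(x), one has 0.999999·P_{k,k}(log x)·log N/(x^k·(log x)^{k+1}) < g_{k,N}(x) < P_{k,k}(log x)·log N/(x^k·(log x)^{k+1}). -/
open Polynomial in
/-- The polynomials `P_{k,k}`: `P_{1,1}(t) = 1` and
`P_{k+1,k+1}(t) = (k t + k + 1) P_{k,k}(t) - t P_{k,k}'(t)`. -/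
noncomputable def Pkk : ℕ → Polynomial ℝ
  | 0 => 1
  | 1 => 1
  | (k + 2) => (C ((k : ℝ) + 1) * X + C ((k : ℝ) + 2)) * Pkk (k + 1)
      - X * derivative (Pkk (k + 1))

open Polynomial in
theorem Pkk_succ (k : ℕ) :
    Pkk (k + 1) = (C (k : ℝ) * X + C ((k : ℝ) + 1)) * Pkk k - X * derivative (Pkk k) := by
  cases k with
  | zero => simp [Pkk]
  | succ k =>
    rw [Pkk]
    push_cast
    rw [add_assoc (k : ℝ) 1 1, one_add_one_eq_two]

theorem eval_Pkk_values (t : ℝ) :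
    (Pkk 0).eval t = 1 ∧ (Pkk 1).eval t = 1 ∧ (Pkk 2).eval t = t + 2 ∧
    (Pkk 3).eval t = 2 * t ^ 2 + 6 * t + 6 ∧
    (Pkk 4).eval t = 6 * t ^ 3 + 22 * t ^ 2 + 36 * t + 24 ∧
    (Pkk 5).eval t = 24 * t ^ 4 + 100 * t ^ 3 + 210 * t ^ 2 + 240 * t + 120 ∧
    (Pkk 6).eval t =
      120 * t ^ 5 + 548 * t ^ 4 + 1350 * t ^ 3 + 2040 * t ^ 2 + 1800 * t + 720 := by
  refine ⟨by simp [Pkk], by simp [Pkk], ?_, ?_, ?_, ?_, ?_⟩ <;> simp [Pkk] <;> ring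

theorem eval_Pkk_pos {k : ℕ} (hk : k ≤ 6) {t : ℝ} (ht : 0 < t) : 0 < (Pkk k).eval t := by
  obtain ⟨h0, h1, h2, h3, h4, h5, h6⟩ := eval_Pkk_values t
  interval_cases k <;> simp only [h0, h1, h2, h3, h4, h5, h6] <;> positivity

theorem sum_choose_mul_factorial_mul_eval_Pkk_le {k : ℕ} (hk1 : 1 ≤ k) (hk6 : k ≤ 6)
    {t : ℝ} (ht : 1 ≤ t) :
    ∑ i ∈ Finset.range (k + 1), (k.choose i : ℝ) * i.factorial * ((Pkk (k - i)).eval t * t ^ i)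
      ≤ 100 * (t * (Pkk k).eval t) := by
  obtain ⟨h0, h1, h2, h3, h4, h5, h6⟩ := eval_Pkk_values t
  obtain ⟨s, rfl⟩ : ∃ s, t = 1 + s := ⟨t - 1, by ring⟩
  have hs : 0 ≤ s := by linarith
  interval_cases k <;>
    simp only [Finset.sum_range_succ, Finset.sum_range_zero, Nat.choose, Nat.factorial,
      Nat.reduceAdd, Nat.reduceSub, h0, h1, h2, h3, h4, h5, h6] <;>
    rw [← sub_nonneg] <;> push_cast <;> ring_nf <;> positivity

/-- If `F (n + 1)` is the derivative of `F n` on an open set for every `n`, then `F n` is the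
`n`-th iterated derivative of `F 0` there. -/
theorem iteratedDeriv_eq_of_hasDerivAt {s : Set ℝ} (hs : IsOpen s) {F : ℕ → ℝ → ℝ}
    (hF : ∀ n, ∀ y ∈ s, HasDerivAt (F n) (F (n + 1) y) y) (n : ℕ) :
    ∀ y ∈ s, iteratedDeriv n (F 0) y = F n y := by
  induction n with
  | zero => simp
  | succ n ih =>
    intro y hy
    rw [iteratedDeriv_succ]
    have h : iteratedDeriv n (F 0) =ᶠ[nhds y] F n := by
      filter_upwards [hs.mem_nhds hy] with z hz using ih z hz
    rw [h.deriv_eq, (hF n y hy).deriv]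

theorem iteratedDeriv_inv_log (n : ℕ) {y : ℝ} (hy : 1 < y) :
    iteratedDeriv n (fun z : ℝ => (Real.log z)⁻¹) y
      = (-1) ^ n * ((Pkk n).eval (Real.log y) / (y ^ n * Real.log y ^ (n + 1))) := by
  have key := iteratedDeriv_eq_of_hasDerivAt (isOpen_Ioi (a := (1 : ℝ)))
    (F := fun n z => (-1) ^ n * ((Pkk n).eval (Real.log z) / (z ^ n * Real.log z ^ (n + 1))))
    (by
      intro n z hz
      have hz0 : z ≠ 0 := (zero_lt_one.trans hz).ne'
      have hl : Real.log z ≠ 0 := (Real.log_pos hz).ne'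
      have hlog := Real.hasDerivAt_log hz0
      have hnum := ((Pkk n).hasDerivAt (Real.log z)).comp z hlog
      have hden := (hasDerivAt_pow n z).mul (hlog.pow (n + 1))
      have h := (hnum.div hden (mul_ne_zero (pow_ne_zero _ hz0) (pow_ne_zero _ hl))).const_mul
        ((-1 : ℝ) ^ n)
      refine h.congr_deriv ?_
      simp only [Pkk_succ, Polynomial.eval_sub, Polynomial.eval_mul, Polynomial.eval_add,
        Polynomial.eval_C, Polynomial.eval_X, Function.comp_apply, Pi.mul_apply, Pi.pow_apply]
      cases n with
      | zero => field_simp; simp; ring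
      | succ n =>
        simp only [Nat.add_sub_cancel]
        push_cast
        field_simp
        ring) n y hy
  simpa [Pkk] using key

theorem iteratedDeriv_log_sub_log (n : ℕ) {y : ℝ} (hy : 1 < y) :
    iteratedDeriv (n + 1) (fun z : ℝ => Real.log z - Real.log (z - 1)) y
      = (-1) ^ (n + 1) * (n.factorial * (((y - 1) ^ (n + 1))⁻¹ - (y ^ (n + 1))⁻¹)) := by
  have hderiv : deriv (fun z : ℝ => Real.log z - Real.log (z - 1))
      =ᶠ[nhds y] fun z => z⁻¹ - (z - 1)⁻¹ := by
    filter_upwards [isOpen_Ioi.mem_nhds hy] with z hz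
    have hz0 : z ≠ 0 := (zero_lt_one.trans hz).ne'
    have hz1 : z - 1 ≠ 0 := (sub_pos.2 hz).ne'
    have h := (Real.hasDerivAt_log hz0).sub (((hasDerivAt_id z).sub_const 1).log hz1)
    have h' := h.deriv
    simp only [id, one_div] at h'
    exact h'
  rw [iteratedDeriv_succ', hderiv.iteratedDeriv_eq]
  have key := iteratedDeriv_eq_of_hasDerivAt (isOpen_Ioi (a := (1 : ℝ)))
    (F := fun n z => (-1) ^ (n + 1) *
      (n.factorial * (((z - 1) ^ (n + 1))⁻¹ - (z ^ (n + 1))⁻¹)))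
    (by
      intro n z hz
      have hz0 : z ≠ 0 := (zero_lt_one.trans hz).ne'
      have hz1 : z - 1 ≠ 0 := (sub_pos.2 hz).ne'
      have hp := (((hasDerivAt_id z).sub_const 1).pow (n + 1)).inv (pow_ne_zero _ hz1)
      have hq := (hasDerivAt_pow (n + 1) z).inv (pow_ne_zero _ hz0)
      have h := ((hp.sub hq).const_mul (n.factorial : ℝ)).const_mul ((-1 : ℝ) ^ (n + 1))
      refine h.congr_deriv ?_
      simp only [Nat.factorial_succ, Nat.add_sub_cancel, Pi.pow_apply, id]
      push_cast
      field_simp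
      ring) n y hy
  simpa [neg_add_eq_sub] using key

theorem inv_sub_one_pow_sub_inv_pow_le {n : ℕ} {x : ℝ} (hx : 1 < x) (hn : 2 * (n : ℝ) ≤ x) :
    ((x - 1) ^ n)⁻¹ - (x ^ n)⁻¹ ≤ 2 * n / x ^ (n + 1) := by
  have hx0 : 0 < x := by linarith
  have hbern : 1 - n / x ≤ ((x - 1) / x) ^ n := by
    have h := one_add_mul_le_pow (a := -x⁻¹)
      (by have := inv_lt_one_of_one_lt₀ hx; linarith) n
    rwa [mul_neg, ← div_eq_mul_inv, ← sub_eq_add_neg, ← sub_eq_add_neg, ← one_div,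
      one_sub_div (a := 1) hx0.ne'] at h
  have hnx : (n : ℝ) / x ≤ 1 / 2 := by rw [div_le_iff₀ hx0]; linarith
  have hnx0 : 0 ≤ (n : ℝ) / x := by positivity
  have h1 : ((x - 1) ^ n)⁻¹ ≤ (1 + 2 * (n / x)) * (x ^ n)⁻¹ := by
    have hp : 0 < (x - 1) ^ n := pow_pos (by linarith) n
    rw [inv_le_iff_one_le_mul₀ hp]
    rw [show (1 + 2 * (n / x)) * (x ^ n)⁻¹ * (x - 1) ^ n
      = (1 + 2 * (n / x)) * ((x - 1) / x) ^ n by rw [div_pow]; ring]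
    refine le_trans ?_ (mul_le_mul_of_nonneg_left hbern (by positivity))
    nlinarith
  calc _ ≤ (1 + 2 * (n / x)) * (x ^ n)⁻¹ - (x ^ n)⁻¹ := by linarith
    _ = _ := by field_simp; ring

theorem iteratedDeriv_log_sub_log_bounds (i : ℕ) {x : ℝ} (hx : 2 < x) (hi : 2 * (i : ℝ) ≤ x) :
    0 < (-1) ^ i * iteratedDeriv i (fun z : ℝ => Real.log z - Real.log (z - 1)) x ∧
    (-1) ^ i * iteratedDeriv i (fun z : ℝ => Real.log z - Real.log (z - 1)) x
      ≤ 2 * i.factorial / x ^ (i + 1) := by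
  have hx1 : 0 < x - 1 := by linarith
  cases i with
  | zero =>
    simp only [iteratedDeriv_zero, pow_zero, one_mul, Nat.factorial, zero_add, pow_one]
    refine ⟨sub_pos.2 (Real.log_lt_log hx1 (by linarith)), ?_⟩
    rw [← Real.log_div (by linarith) hx1.ne']
    refine (Real.log_le_sub_one_of_pos (by positivity)).trans ?_
    rw [div_sub_one hx1.ne', div_le_div_iff₀ hx1 (by linarith)]
    push_cast
    linarith
  | succ n =>
    rw [iteratedDeriv_log_sub_log n (by linarith), ← mul_assoc, ← mul_pow]
    simp only [mul_neg, mul_one, neg_neg, one_pow, one_mul]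
    constructor
    · refine mul_pos (by positivity) (sub_pos.2 ?_)
      exact inv_strictAnti₀ (pow_pos hx1 _) (pow_lt_pow_left₀ (by linarith) hx1.le (by simp))
    · refine (mul_le_mul_of_nonneg_left
        (inv_sub_one_pow_sub_inv_pow_le (by linarith) hi) (by positivity)).trans_eq ?_
      rw [Nat.factorial_succ]
      push_cast
      ring

theorem neg_one_pow_mul_iteratedDeriv_eq (N : ℝ) {k : ℕ} (hk : 0 < k) {x : ℝ} (hx : 1 < x) :
    (-1 : ℝ) ^ k
        * iteratedDeriv k (fun y : ℝ => (Real.log N + Real.log (y - 1)) / Real.log y) x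
      = (Pkk k).eval (Real.log x) * Real.log N / (x ^ k * Real.log x ^ (k + 1))
        - ∑ i ∈ Finset.range (k + 1), (k.choose i : ℝ)
          * ((-1) ^ i * iteratedDeriv i (fun z : ℝ => Real.log z - Real.log (z - 1)) x)
          * ((Pkk (k - i)).eval (Real.log x) / (x ^ (k - i) * Real.log x ^ (k - i + 1))) := by
  have hx0 : x ≠ 0 := by linarith
  have hl : Real.log x ≠ 0 := (Real.log_pos hx).ne'
  have hu : ContDiffAt ℝ k (fun z : ℝ => Real.log z - Real.log (z - 1)) x :=
    (contDiffAt_id.log hx0).sub ((contDiffAt_id.sub contDiffAt_const).log (sub_pos.2 hx).ne')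
  have hv : ContDiffAt ℝ k (fun z : ℝ => (Real.log z)⁻¹) x := (contDiffAt_id.log hx0).inv hl
  have huv : ContDiffAt ℝ k ((fun z : ℝ => Real.log z - Real.log (z - 1))
      * fun z : ℝ => (Real.log z)⁻¹) x := hu.mul hv
  have hcongr : (fun y : ℝ => (Real.log N + Real.log (y - 1)) / Real.log y)
      =ᶠ[nhds x] fun y => 1 + ((fun z : ℝ => Real.log N * (Real.log z)⁻¹)
        - (fun z : ℝ => Real.log z - Real.log (z - 1)) * fun z : ℝ => (Real.log z)⁻¹) y := by
    filter_upwards [isOpen_Ioi.mem_nhds hx] with y hy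
    have hly : Real.log y ≠ 0 := (Real.log_pos hy).ne'
    simp only [Pi.sub_apply, Pi.mul_apply]
    field_simp
    ring
  rw [hcongr.iteratedDeriv_eq, iteratedDeriv_const_add hk,
    iteratedDeriv_sub (contDiffAt_const.mul hv) huv, iteratedDeriv_const_mul_field,
    iteratedDeriv_mul hu hv, iteratedDeriv_inv_log k hx, mul_sub, Finset.mul_sum]
  have hsign (n : ℕ) : (-1 : ℝ) ^ n * (-1) ^ n = 1 := by simp [← mul_pow]
  congr 1
  · linear_combination ((Pkk k).eval (Real.log x) * Real.log N
      / (x ^ k * Real.log x ^ (k + 1))) * hsign k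
  · refine Finset.sum_congr rfl fun i hi => ?_
    obtain ⟨j, rfl⟩ := Nat.exists_eq_add_of_le (Finset.mem_range_succ_iff.1 hi)
    rw [iteratedDeriv_inv_log _ hx, Nat.add_sub_cancel_left, pow_add]
    linear_combination (((i + j).choose i : ℝ) * (-1) ^ i
      * iteratedDeriv i (fun z : ℝ => Real.log z - Real.log (z - 1)) x
      * ((Pkk j).eval (Real.log x) / (x ^ j * Real.log x ^ (j + 1)))) * hsign j

theorem log_le_mul_of_large {x : ℝ} (hx : (10 : ℝ) ^ (5 : ℕ) ≤ x) :
    Real.log x ≤ 0.0005 * x := by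
  have hx0 : 0 < x := lt_of_lt_of_le (by positivity) hx
  have h10 : Real.log 10 ≤ 9 := by
    have := Real.log_le_sub_one_of_pos (show (0 : ℝ) < 10 by norm_num)
    linarith
  have h := Real.log_le_sub_one_of_pos (show 0 < x / 10 ^ 5 by positivity)
  rw [Real.log_div hx0.ne' (by norm_num), Real.log_pow] at h
  norm_num at h hx
  linarith

theorem one_lt_log_ten : 1 < Real.log 10 := by
  rw [Real.lt_log_iff_exp_lt (by norm_num)]
  have := Real.exp_one_lt_d9
  linarith

theorem stmt8 (N : ℝ) (hN : (10 : ℝ) ^ (100000 : ℕ) ≤ N)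
    (k : ℕ) (hk1 : 1 ≤ k) (hk6 : k ≤ 6) (x : ℝ) (hx : (10 : ℝ) ^ (5 : ℕ) ≤ x) :
    0.999999 * (Pkk k).eval (Real.log x) * Real.log N / (x ^ k * Real.log x ^ (k + 1))
      < (-1 : ℝ) ^ k
          * iteratedDeriv k (fun y : ℝ => (Real.log N + Real.log (y - 1)) / Real.log y) x ∧
    (-1 : ℝ) ^ k
        * iteratedDeriv k (fun y : ℝ => (Real.log N + Real.log (y - 1)) / Real.log y) x
      < (Pkk k).eval (Real.log x) * Real.log N / (x ^ k * Real.log x ^ (k + 1)) := by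
  have hx' : (100000 : ℝ) ≤ x := by norm_num at hx; exact hx
  have hx0 : 0 < x := by linarith
  have hlogN : 100000 < Real.log N := by
    have h := Real.log_le_log (by positivity) hN
    rw [Real.log_pow] at h
    have := one_lt_log_ten
    push_cast at h
    linarith
  have hL1 : 1 ≤ Real.log x :=
    one_lt_log_ten.le.trans (Real.log_le_log (by norm_num) (by linarith))
  have hLx := log_le_mul_of_large hx
  have hu (i : ℕ) (hi : i ∈ Finset.range (k + 1)) :=
    iteratedDeriv_log_sub_log_bounds i (x := x) (by linarith)
      (by
        have : (i : ℝ) ≤ 6 := by exact_mod_cast (Finset.mem_range_succ_iff.1 hi).trans hk6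
        linarith)
  have hsum := sum_choose_mul_factorial_mul_eval_Pkk_le hk1 hk6 hL1
  rw [neg_one_pow_mul_iteratedDeriv_eq N hk1 (by linarith)]
  set L := Real.log x
  have hL0 : 0 < L := by linarith
  have hP (i : ℕ) : 0 < (Pkk (k - i)).eval L := eval_Pkk_pos (by omega) hL0
  have hPk : 0 < (Pkk k).eval L := eval_Pkk_pos hk6 hL0
  constructor
  · refine lt_sub_comm.1 (lt_of_le_of_lt (Finset.sum_le_sum fun i hi => ?_)
      (lt_of_le_of_lt (b := 2 / x / (x ^ k * L ^ (k + 1)) * ∑ i ∈ Finset.range (k + 1),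
        (k.choose i : ℝ) * i.factorial * ((Pkk (k - i)).eval L * L ^ i))
        (Finset.mul_sum _ _ _).ge ?_))
    · refine (mul_le_mul_of_nonneg_right (mul_le_mul_of_nonneg_left (hu i hi).2
        (by positivity)) (div_nonneg (hP i).le (by positivity))).trans_eq ?_
      obtain ⟨j, rfl⟩ := Nat.exists_eq_add_of_le (Finset.mem_range_succ_iff.1 hi)
      rw [Nat.add_sub_cancel_left]
      field_simp
      ring
    · refine lt_of_le_of_lt (mul_le_mul_of_nonneg_left hsum (by positivity)) ?_
      have hcoef : 200 * L / x < 0.000001 * Real.log N := by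
        rw [div_lt_iff₀ hx0]
        nlinarith
      have hpos : 0 < (Pkk k).eval L / (x ^ k * L ^ (k + 1)) := by positivity
      have h := mul_lt_mul_of_pos_right hcoef hpos
      calc _ = 200 * L / x * ((Pkk k).eval L / (x ^ k * L ^ (k + 1))) := by ring
        _ < _ := h
        _ = _ := by ring
  · refine sub_lt_self _ (Finset.sum_pos (fun i hi => ?_) (by simp))
    have hc : 0 < (k.choose i : ℝ) := by
      exact_mod_cast Nat.choose_pos (Finset.mem_range_succ_iff.1 hi)
    exact mul_pos (mul_pos hc (hu i hi).1) (div_pos (hP i) (by positivity))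
end

section
/- Let N ≥ 10^{100000} be a real number, M ≥ 10^5 a real number, and 1 ≤ k ≤ 6 an integer. Then for every real x with M ≤ x ≤ 2M, one has 0.999999 < f_N^{(k)}(M)/f_N^{(k)}(x) < γ_k, where γ_1 = 2.24808, γ_2 = 4.53426, γ_3 = 9.11515, γ_4 = 18.2994, γ_5 = 36.7099, γ_6 = 73.6077. -/
open Real Finset

/-- The polynomials with `(1 / log)⁽ᵏ⁾(x) = (-1)ᵏ x⁻ᵏ Pₖ(1 / log x)`. -/
noncomputable def invLogPoly : ℕ → Polynomial ℝ
  | 0 => Polynomial.X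
  | k + 1 => (k : Polynomial ℝ) * invLogPoly k
      + Polynomial.X ^ 2 * Polynomial.derivative (invLogPoly k)

lemma eval_invLogPoly_zero (u : ℝ) : (invLogPoly 0).eval u = u := by
  simp [invLogPoly]

lemma eval_invLogPoly_one (u : ℝ) : (invLogPoly 1).eval u = u ^ 2 := by
  simp [invLogPoly]

lemma eval_invLogPoly_two (u : ℝ) : (invLogPoly 2).eval u = u ^ 2 + 2 * u ^ 3 := by
  simp [invLogPoly]
  ring

lemma eval_invLogPoly_three (u : ℝ) :
    (invLogPoly 3).eval u = 2 * u ^ 2 + 6 * u ^ 3 + 6 * u ^ 4 := by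
  simp [invLogPoly]
  ring

lemma eval_invLogPoly_four (u : ℝ) :
    (invLogPoly 4).eval u = 6 * u ^ 2 + 22 * u ^ 3 + 36 * u ^ 4 + 24 * u ^ 5 := by
  simp [invLogPoly]
  ring

lemma eval_invLogPoly_five (u : ℝ) :
    (invLogPoly 5).eval u
      = 24 * u ^ 2 + 100 * u ^ 3 + 210 * u ^ 4 + 240 * u ^ 5 + 120 * u ^ 6 := by
  simp [invLogPoly]
  ring

lemma eval_invLogPoly_six (u : ℝ) :
    (invLogPoly 6).eval u
      = 120 * u ^ 2 + 548 * u ^ 3 + 1350 * u ^ 4 + 2040 * u ^ 5 + 1800 * u ^ 6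
        + 720 * u ^ 7 := by
  simp [invLogPoly]
  ring

lemma coeff_invLogPoly_nonneg (k i : ℕ) : 0 ≤ (invLogPoly k).coeff i := by
  induction k generalizing i with
  | zero =>
    simp only [invLogPoly, Polynomial.coeff_X]
    split_ifs <;> norm_num
  | succ k ih =>
    simp only [invLogPoly, Polynomial.coeff_add, Polynomial.coeff_natCast_mul,
      Polynomial.coeff_X_pow_mul', Polynomial.coeff_derivative]
    have := ih i
    have := ih (i - 2 + 1)
    split_ifs <;> positivity

lemma eval_invLogPoly_nonneg (k : ℕ) {u : ℝ} (hu : 0 ≤ u) : 0 ≤ (invLogPoly k).eval u := by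
  rw [Polynomial.eval_eq_sum_range]
  exact sum_nonneg fun i _ => mul_nonneg (coeff_invLogPoly_nonneg k i) (pow_nonneg hu i)

lemma eval_invLogPoly_mono (k : ℕ) {u v : ℝ} (hu : 0 ≤ u) (huv : u ≤ v) :
    (invLogPoly k).eval u ≤ (invLogPoly k).eval v := by
  simp only [Polynomial.eval_eq_sum_range]
  gcongr with i
  exact coeff_invLogPoly_nonneg k i

lemma iteratedDeriv_inv_log_s10 (k : ℕ) {x : ℝ} (hx : 1 < x) :
    iteratedDeriv k (fun y : ℝ => (log y)⁻¹) x
      = (-1) ^ k * (x ^ k)⁻¹ * (invLogPoly k).eval (log x)⁻¹ := by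
  induction k generalizing x with
  | zero => simp [invLogPoly]
  | succ k ih =>
    have hx0 : x ≠ 0 := by positivity
    have hl : log x ≠ 0 := (log_pos hx).ne'
    have hev : iteratedDeriv k (fun y : ℝ => (log y)⁻¹) =ᶠ[nhds x]
        fun y => (-1) ^ k * (y ^ k)⁻¹ * (invLogPoly k).eval (log y)⁻¹ := by
      filter_upwards [lt_mem_nhds hx] with y hy using ih hy
    have hinv : HasDerivAt (fun y : ℝ => (log y)⁻¹) (-x⁻¹ / log x ^ 2) x :=
      (hasDerivAt_log hx0).inv hl
    have hP := ((invLogPoly k).hasDerivAt (log x)⁻¹).comp x hinv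
    have hpow := ((hasDerivAt_pow k x).inv (pow_ne_zero k hx0)).const_mul ((-1 : ℝ) ^ k)
    rw [iteratedDeriv_succ, hev.deriv_eq]
    refine (hpow.mul hP).deriv.trans ?_
    simp only [Function.comp, Pi.inv_apply, invLogPoly, Polynomial.eval_add, Polynomial.eval_mul,
      Polynomial.eval_natCast, Polynomial.eval_pow, Polynomial.eval_X]
    rcases k with _ | k
    · simp
      field_simp
    · simp only [Nat.add_sub_cancel]
      field_simp
      ring

lemma iteratedDeriv_succ_log_sub_log (k : ℕ) {x : ℝ} (hx : 1 < x) :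
    iteratedDeriv (k + 1) (fun y : ℝ => log (y - 1) - log y) x
      = (-1) ^ k * (k.factorial : ℝ) * (((x - 1) ^ (k + 1))⁻¹ - (x ^ (k + 1))⁻¹) := by
  induction k generalizing x with
  | zero =>
    have h1 := ((hasDerivAt_id x).sub_const 1).log (sub_pos.2 hx).ne'
    have h2 := hasDerivAt_log (show x ≠ 0 by positivity)
    rw [zero_add, iteratedDeriv_one]
    refine (h1.sub h2).deriv.trans ?_
    simp
  | succ k ih =>
    have hx0 : x ≠ 0 := by positivity
    have hx1 : x - 1 ≠ 0 := (sub_pos.2 hx).ne'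
    have hev : iteratedDeriv (k + 1) (fun y : ℝ => log (y - 1) - log y) =ᶠ[nhds x]
        fun y => (-1) ^ k * (k.factorial : ℝ) * (((y - 1) ^ (k + 1))⁻¹ - (y ^ (k + 1))⁻¹) := by
      filter_upwards [lt_mem_nhds hx] with y hy using ih hy
    have h1 := (((hasDerivAt_id x).sub_const 1).pow (k + 1)).inv (pow_ne_zero (k + 1) hx1)
    have h2 := (hasDerivAt_pow (k + 1) x).inv (pow_ne_zero (k + 1) hx0)
    rw [iteratedDeriv_succ, hev.deriv_eq]
    refine ((h1.sub h2).const_mul _).deriv.trans ?_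
    simp only [id, Pi.pow_apply, Nat.add_sub_cancel, Nat.factorial_succ]
    push_cast
    field_simp
    ring

/-- The `j`-th derivative of `-log (1 - 1 / x)`, rescaled by `(-x) ^ j`. -/
noncomputable def scaledLogDeriv (j : ℕ) (x : ℝ) : ℝ :=
  -((-1) ^ j * x ^ j * iteratedDeriv j (fun y : ℝ => log (y - 1) - log y) x)

lemma scaledLogDeriv_succ (j : ℕ) {x : ℝ} (hx : 1 < x) :
    scaledLogDeriv (j + 1) x = (j.factorial : ℝ) * ((x / (x - 1)) ^ (j + 1) - 1) := by
  have hx0 : x ≠ 0 := by positivity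
  have hx1 : x - 1 ≠ 0 := (sub_pos.2 hx).ne'
  have hs : ((-1 : ℝ) ^ j) * (-1) ^ j = 1 := by rw [← mul_pow]; simp
  rw [scaledLogDeriv, iteratedDeriv_succ_log_sub_log j hx, div_pow]
  have hx' : x ^ (j + 1) * (x ^ (j + 1))⁻¹ = 1 := mul_inv_cancel₀ (pow_ne_zero _ hx0)
  rw [pow_succ (-1 : ℝ), div_eq_mul_inv]
  linear_combination
    (j.factorial : ℝ) * (x ^ (j + 1) * ((x - 1) ^ (j + 1))⁻¹ - x ^ (j + 1) * (x ^ (j + 1))⁻¹) * hs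
      - (j.factorial : ℝ) * hx'

lemma scaledLogDeriv_nonneg (j : ℕ) {x : ℝ} (hx : 1 < x) : 0 ≤ scaledLogDeriv j x := by
  have hx1 : 0 < x - 1 := sub_pos.2 hx
  rcases j with _ | j
  · have := log_le_log hx1 (sub_le_self x zero_le_one)
    simpa [scaledLogDeriv] using this
  · rw [scaledLogDeriv_succ j hx]
    have : 1 ≤ x / (x - 1) := by rw [le_div_iff₀ hx1]; linarith
    exact mul_nonneg (by positivity) (sub_nonneg.2 (one_le_pow₀ this))

lemma scaledLogDeriv_le {j : ℕ} (hj : j ≤ 6) {x : ℝ} (hx : 100000 ≤ x) :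
    scaledLogDeriv j x ≤ 1.001 * j.factorial / x := by
  have hx1 : 0 < x - 1 := by linarith
  have hx0 : 0 < x := by linarith
  have ht0 : 0 < x⁻¹ := by positivity
  have ht : (x - 1)⁻¹ ≤ 1.0001 * x⁻¹ := by
    rw [inv_le_iff_one_le_mul₀ hx1]
    field_simp
    linarith
  have hx5 : x⁻¹ ≤ 0.00001 := by
    rw [inv_le_comm₀ hx0 (by norm_num)]; norm_num; linarith
  rcases j with _ | j
  · have h := log_le_sub_one_of_pos (div_pos hx0 hx1)
    rw [log_div hx0.ne' hx1.ne'] at h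
    have h2 : x / (x - 1) - 1 = (x - 1)⁻¹ := by field_simp; ring
    simp only [scaledLogDeriv, iteratedDeriv_zero, div_eq_mul_inv, Nat.factorial, pow_zero]
    push_cast
    linarith
  · rw [scaledLogDeriv_succ j (by linarith)]
    have h2 : x / (x - 1) = 1 + (x - 1)⁻¹ := by field_simp; ring
    have h3 : x / (x - 1) ≤ 1 + 1.0001 * x⁻¹ := by linarith
    have h4 : (x / (x - 1)) ^ (j + 1) ≤ (1 + 1.0001 * x⁻¹) ^ (j + 1) := by gcongr
    have h5 : (1 + 1.0001 * x⁻¹) ^ (j + 1) - 1 ≤ 1.001 * (j + 1) * x⁻¹ := by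
      generalize x⁻¹ = t at *
      have e1 : t ^ 2 ≤ 0.00001 * t := by nlinarith
      have e2 : t ^ 3 ≤ 0.00001 * t := by nlinarith
      have e3 : t ^ 4 ≤ 0.00001 * t := by nlinarith
      have e4 : t ^ 5 ≤ 0.00001 * t := by nlinarith
      have e5 : t ^ 6 ≤ 0.00001 * t := by nlinarith
      have : j ≤ 5 := by omega
      interval_cases j <;> norm_num <;> ring_nf <;> linarith
    rw [Nat.factorial_succ, div_eq_mul_inv]
    push_cast
    calc (j.factorial : ℝ) * ((x / (x - 1)) ^ (j + 1) - 1)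
        ≤ j.factorial * (1.001 * (j + 1) * x⁻¹) := by gcongr; linarith
      _ = _ := by ring

lemma scaled_iteratedDeriv_eq (L : ℝ) {k : ℕ} (hk : 0 < k) {x : ℝ} (hx : 1 < x) :
    (-1) ^ k * x ^ k * iteratedDeriv k (fun y : ℝ => (L + log (y - 1)) / log y) x
      = L * (invLogPoly k).eval (log x)⁻¹
        - ∑ j ∈ range (k + 1),
          (k.choose j : ℝ) * scaledLogDeriv j x * (invLogPoly (k - j)).eval (log x)⁻¹ := by
  have hx0 : x ≠ 0 := by positivity
  have hx1 : x - 1 ≠ 0 := (sub_pos.2 hx).ne'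
  have hl : log x ≠ 0 := (log_pos hx).ne'
  have hg : ContDiffAt ℝ k (fun y : ℝ => (log y)⁻¹) x := (contDiffAt_log.2 hx0).inv hl
  have hw : ContDiffAt ℝ k (fun y : ℝ => log (y - 1) - log y) x :=
    ((contDiffAt_id.sub contDiffAt_const).log hx1).sub (contDiffAt_log.2 hx0)
  have hev : (fun y : ℝ => (L + log (y - 1)) / log y) =ᶠ[nhds x]
      fun y => 1 + (L * (log y)⁻¹ + (log (y - 1) - log y) * (log y)⁻¹) := by
    filter_upwards [lt_mem_nhds hx] with y hy
    have := (log_pos hy).ne'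
    field_simp
    ring
  rw [hev.iteratedDeriv_eq, iteratedDeriv_const_add hk,
    iteratedDeriv_fun_add (contDiffAt_const.mul hg) (hw.mul hg),
    iteratedDeriv_const_mul L hg, iteratedDeriv_inv_log_s10 k hx]
  have hs : ((-1 : ℝ) ^ k) * (-1) ^ k = 1 := by rw [← mul_pow]; simp
  have hx' : x ^ k * (x ^ k)⁻¹ = 1 := mul_inv_cancel₀ (pow_ne_zero _ hx0)
  have hmul := iteratedDeriv_mul hw hg
  rw [show (fun y : ℝ => (log (y - 1) - log y) * (log y)⁻¹)
    = (fun y : ℝ => log (y - 1) - log y) * fun y : ℝ => (log y)⁻¹ from rfl, hmul, mul_add,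
    sub_eq_add_neg, ← sum_neg_distrib, mul_sum]
  congr 1
  · linear_combination L * (invLogPoly k).eval (log x)⁻¹ * (x ^ k * (x ^ k)⁻¹ * hs + hx')
  · refine sum_congr rfl fun j hj => ?_
    obtain ⟨i, rfl⟩ := Nat.exists_eq_add_of_le (Nat.lt_succ_iff.1 (mem_range.1 hj))
    have hsi : ((-1 : ℝ) ^ i) * (-1) ^ i = 1 := by rw [← mul_pow]; simp
    have hxi : x ^ i * (x ^ i)⁻¹ = 1 := mul_inv_cancel₀ (pow_ne_zero _ hx0)
    rw [Nat.add_sub_cancel_left, iteratedDeriv_inv_log_s10 i hx, scaledLogDeriv, pow_add, pow_add]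
    linear_combination ((j + i).choose j : ℝ) * (-1) ^ j * x ^ j
      * iteratedDeriv j (fun y : ℝ => log (y - 1) - log y) x * (invLogPoly i).eval (log x)⁻¹
      * (x ^ i * (x ^ i)⁻¹ * hsi + hxi)

lemma sum_choose_mul_invLogPoly_le {k : ℕ} (hk1 : 1 ≤ k) (hk6 : k ≤ 6) {u : ℝ}
    (hu0 : 0 ≤ u) (hu1 : u ≤ 0.1) :
    ∑ j ∈ range (k + 1), (k.choose j : ℝ) * j.factorial * (invLogPoly (k - j)).eval u * u
      ≤ 190 * (invLogPoly k).eval u := by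
  have h2 := pow_nonneg hu0 2
  have h3 : u ^ 3 ≤ 0.1 * u ^ 2 := by nlinarith
  have h4 : u ^ 4 ≤ 0.1 * u ^ 3 := by nlinarith [pow_nonneg hu0 3]
  have h5 : u ^ 5 ≤ 0.1 * u ^ 4 := by nlinarith [pow_nonneg hu0 4]
  have h6 : u ^ 6 ≤ 0.1 * u ^ 5 := by nlinarith [pow_nonneg hu0 5]
  have h7 : u ^ 7 ≤ 0.1 * u ^ 6 := by nlinarith [pow_nonneg hu0 6]
  have h8 : u ^ 8 ≤ 0.1 * u ^ 7 := by nlinarith [pow_nonneg hu0 7]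
  have h8' := pow_nonneg hu0 8
  interval_cases k <;>
  · simp [sum_range_succ, Nat.choose, Nat.factorial, eval_invLogPoly_zero, eval_invLogPoly_one,
      eval_invLogPoly_two, eval_invLogPoly_three, eval_invLogPoly_four, eval_invLogPoly_five,
      eval_invLogPoly_six]
    ring_nf
    linarith

lemma log_ten_gt : 2.3025850926 < log 10 := by
  rw [log_ten_eq]
  linarith [log_two_gt_d9, log_five_gt_d9]

lemma log_hundred_thousand : log 100000 = 5 * log 10 := by
  rw [show (100000 : ℝ) = 10 ^ 5 by norm_num, log_pow]
  norm_num

lemma inv_log_le {x : ℝ} (hx : 100000 ≤ x) : (log x)⁻¹ ≤ 0.0868588965 := by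
  have h := log_le_log (by norm_num) hx
  rw [log_hundred_thousand] at h
  have := log_ten_gt
  rw [inv_le_comm₀ (by linarith) (by norm_num)]
  norm_num at *
  linarith

lemma inv_le_inv_log {x : ℝ} (hx : 100000 ≤ x) : x⁻¹ ≤ 0.000116 * (log x)⁻¹ := by
  have h1 : exp 1 ≤ 100000 := by linarith [exp_one_lt_d9]
  have h := log_div_self_antitoneOn h1 (h1.trans hx) hx
  have hl : 0 < log x := log_pos (by linarith)
  have hx0 : 0 < x := by linarith
  simp only [log_hundred_thousand, log_ten_eq] at h
  have h2 : log x / x ≤ 0.000116 := by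
    linarith [log_two_lt_d9, log_five_lt_d9]
  rw [← div_eq_mul_inv, le_div_iff₀ hl, inv_mul_eq_div]
  exact h2

lemma scaled_iteratedDeriv_bounds {L : ℝ} (hL : 230000 ≤ L) {k : ℕ} (hk1 : 1 ≤ k) (hk6 : k ≤ 6)
    {x : ℝ} (hx : 100000 ≤ x) :
    (1 - 1 / 10 ^ 7) * (L * (invLogPoly k).eval (log x)⁻¹)
        ≤ (-1) ^ k * x ^ k * iteratedDeriv k (fun y : ℝ => (L + log (y - 1)) / log y) x ∧
      (-1) ^ k * x ^ k * iteratedDeriv k (fun y : ℝ => (L + log (y - 1)) / log y) x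
        ≤ L * (invLogPoly k).eval (log x)⁻¹ := by
  have hx1 : 1 < x := by linarith
  have hu0 : 0 ≤ (log x)⁻¹ := inv_nonneg.2 (log_pos hx1).le
  have hu1 : (log x)⁻¹ ≤ 0.1 := (inv_log_le hx).trans (by norm_num)
  have hxu := inv_le_inv_log hx
  rw [scaled_iteratedDeriv_eq L hk1 hx1]
  set u := (log x)⁻¹
  have hP := eval_invLogPoly_nonneg k hu0
  constructor
  · have key : ∑ j ∈ range (k + 1),
        (k.choose j : ℝ) * scaledLogDeriv j x * (invLogPoly (k - j)).eval u
        ≤ 0.00011612 * ∑ j ∈ range (k + 1),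
          (k.choose j : ℝ) * j.factorial * (invLogPoly (k - j)).eval u * u := by
      rw [mul_sum]
      refine sum_le_sum fun j hj => ?_
      have hj6 : j ≤ 6 := (Nat.lt_succ_iff.1 (mem_range.1 hj)).trans hk6
      have hPj := eval_invLogPoly_nonneg (k - j) hu0
      have h1 : scaledLogDeriv j x ≤ 0.00011612 * j.factorial * u := by
        refine (scaledLogDeriv_le hj6 hx).trans ?_
        rw [div_eq_mul_inv]
        have : (0 : ℝ) ≤ j.factorial := by positivity
        nlinarith [mul_le_mul_of_nonneg_left hxu this, mul_nonneg this hu0]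
      calc (k.choose j : ℝ) * scaledLogDeriv j x * (invLogPoly (k - j)).eval u
          ≤ (k.choose j : ℝ) * (0.00011612 * j.factorial * u) * (invLogPoly (k - j)).eval u := by
            gcongr
        _ = _ := by ring
    have h2 := sum_choose_mul_invLogPoly_le hk1 hk6 hu0 hu1
    have h3 := mul_le_mul_of_nonneg_right hL hP
    linarith
  · refine sub_le_self _ (sum_nonneg fun j _ => ?_)
    have := eval_invLogPoly_nonneg (k - j) hu0
    have := scaledLogDeriv_nonneg j hx1
    positivity

/-- The upper bound for the `k`-th ratio. -/
noncomputable def ratioBound (k : ℕ) : ℝ :=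
  if k = 1 then 2.24808 else if k = 2 then 4.53426 else if k = 3 then 9.11515
    else if k = 4 then 18.2994 else if k = 5 then 36.7099 else 73.6077

lemma two_pow_mul_invLogPoly_lt {k : ℕ} (hk1 : 1 ≤ k) (hk6 : k ≤ 6) {u : ℝ}
    (hu0 : 0 < u) (hu1 : u ≤ 0.0868588965) :
    2 ^ k * (invLogPoly k).eval u < ratioBound k *
      ((1 - 1 / 10 ^ 7) * (invLogPoly k).eval (u / (1 + 0.6931471808 * u))) := by
  have hpow (n : ℕ) : u ^ n ≤ 0.0868588965 ^ n := pow_le_pow_left₀ hu0.le hu1 n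
  have hs0 : 0 < 1 + 0.6931471808 * u := by positivity
  obtain ⟨s, hs⟩ : ∃ s, s = 1 + 0.6931471808 * u := ⟨_, rfl⟩
  rw [← hs] at hs0 ⊢
  interval_cases k
  · have key : 2 ^ 1 * (1) * s ^ 2
        < 2.24808 * ((1 - 1 / 10 ^ 7) * (1)) := by
      rw [hs]
      ring_nf
      linarith [hpow 1, hpow 2]
    have h := mul_lt_mul_of_pos_left key (show 0 < u ^ 2 / s ^ 2 by positivity)
    have hb : ratioBound 1 = 2.24808 := by norm_num [ratioBound]
    rw [hb, eval_invLogPoly_one, eval_invLogPoly_one]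
    calc _ = _ := by field_simp
      _ < _ := h
      _ = _ := by field_simp
  · have key : 2 ^ 2 * (1 + 2 * u ^ 1) * s ^ 3
        < 4.53426 * ((1 - 1 / 10 ^ 7) * (1 * s ^ 1 + 2 * u ^ 1)) := by
      rw [hs]
      ring_nf
      linarith [hpow 1, hpow 2, hpow 3, hpow 4]
    have h := mul_lt_mul_of_pos_left key (show 0 < u ^ 2 / s ^ 3 by positivity)
    have hb : ratioBound 2 = 4.53426 := by norm_num [ratioBound]
    rw [hb, eval_invLogPoly_two, eval_invLogPoly_two]
    calc _ = _ := by field_simp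
      _ < _ := h
      _ = _ := by field_simp
  · have key : 2 ^ 3 * (2 + 6 * u ^ 1 + 6 * u ^ 2) * s ^ 4
        < 9.11515 * ((1 - 1 / 10 ^ 7) * (2 * s ^ 2 + 6 * u ^ 1 * s ^ 1 + 6 * u ^ 2)) := by
      rw [hs]
      ring_nf
      linarith [hpow 1, hpow 2, hpow 3, hpow 4, hpow 5, hpow 6]
    have h := mul_lt_mul_of_pos_left key (show 0 < u ^ 2 / s ^ 4 by positivity)
    have hb : ratioBound 3 = 9.11515 := by norm_num [ratioBound]
    rw [hb, eval_invLogPoly_three, eval_invLogPoly_three]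
    calc _ = _ := by field_simp
      _ < _ := h
      _ = _ := by field_simp
  · have key : 2 ^ 4 * (6 + 22 * u ^ 1 + 36 * u ^ 2 + 24 * u ^ 3) * s ^ 5
        < 18.2994 * ((1 - 1 / 10 ^ 7) * (6 * s ^ 3 + 22 * u ^ 1 * s ^ 2 + 36 * u ^ 2 * s ^ 1 + 24 * u ^ 3)) := by
      rw [hs]
      ring_nf
      linarith [hpow 1, hpow 2, hpow 3, hpow 4, hpow 5, hpow 6, hpow 7, hpow 8]
    have h := mul_lt_mul_of_pos_left key (show 0 < u ^ 2 / s ^ 5 by positivity)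
    have hb : ratioBound 4 = 18.2994 := by norm_num [ratioBound]
    rw [hb, eval_invLogPoly_four, eval_invLogPoly_four]
    calc _ = _ := by field_simp
      _ < _ := h
      _ = _ := by field_simp
  · have key : 2 ^ 5 * (24 + 100 * u ^ 1 + 210 * u ^ 2 + 240 * u ^ 3 + 120 * u ^ 4) * s ^ 6
        < 36.7099 * ((1 - 1 / 10 ^ 7) * (24 * s ^ 4 + 100 * u ^ 1 * s ^ 3 + 210 * u ^ 2 * s ^ 2 + 240 * u ^ 3 * s ^ 1 + 120 * u ^ 4)) := by
      rw [hs]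
      ring_nf
      linarith [hpow 1, hpow 2, hpow 3, hpow 4, hpow 5, hpow 6, hpow 7, hpow 8, hpow 9, hpow 10]
    have h := mul_lt_mul_of_pos_left key (show 0 < u ^ 2 / s ^ 6 by positivity)
    have hb : ratioBound 5 = 36.7099 := by norm_num [ratioBound]
    rw [hb, eval_invLogPoly_five, eval_invLogPoly_five]
    calc _ = _ := by field_simp
      _ < _ := h
      _ = _ := by field_simp
  · have key : 2 ^ 6 * (120 + 548 * u ^ 1 + 1350 * u ^ 2 + 2040 * u ^ 3 + 1800 * u ^ 4 + 720 * u ^ 5) * s ^ 7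
        < 73.6077 * ((1 - 1 / 10 ^ 7) * (120 * s ^ 5 + 548 * u ^ 1 * s ^ 4 + 1350 * u ^ 2 * s ^ 3 + 2040 * u ^ 3 * s ^ 2 + 1800 * u ^ 4 * s ^ 1 + 720 * u ^ 5)) := by
      rw [hs]
      ring_nf
      linarith [hpow 1, hpow 2, hpow 3, hpow 4, hpow 5, hpow 6, hpow 7, hpow 8, hpow 9, hpow 10, hpow 11, hpow 12]
    have h := mul_lt_mul_of_pos_left key (show 0 < u ^ 2 / s ^ 7 by positivity)
    have hb : ratioBound 6 = 73.6077 := by norm_num [ratioBound]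
    rw [hb, eval_invLogPoly_six, eval_invLogPoly_six]
    calc _ = _ := by field_simp
      _ < _ := h
      _ = _ := by field_simp


theorem stmt10 (N : ℝ) (hN : (10 : ℝ) ^ (100000 : ℕ) ≤ N)
    (M : ℝ) (hM : (10 : ℝ) ^ (5 : ℕ) ≤ M)
    (k : ℕ) (hk1 : 1 ≤ k) (hk6 : k ≤ 6) (x : ℝ) (hxl : M ≤ x) (hxu : x ≤ 2 * M) :
    0.999999
      < iteratedDeriv k (fun y : ℝ => (Real.log N + Real.log (y - 1)) / Real.log y) M
        / iteratedDeriv k (fun y : ℝ => (Real.log N + Real.log (y - 1)) / Real.log y) x ∧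
    iteratedDeriv k (fun y : ℝ => (Real.log N + Real.log (y - 1)) / Real.log y) M
        / iteratedDeriv k (fun y : ℝ => (Real.log N + Real.log (y - 1)) / Real.log y) x
      < (if k = 1 then 2.24808 else if k = 2 then 4.53426 else if k = 3 then 9.11515
          else if k = 4 then 18.2994 else if k = 5 then 36.7099 else (73.6077 : ℝ)) := by
  have hN0 : (0 : ℝ) < 10 ^ (100000 : ℕ) := pow_pos (by norm_num) _
  have hL : 230000 ≤ log N := by
    have h := log_le_log hN0 hN
    rw [log_pow] at h
    push_cast at h
    linarith [log_ten_gt]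
  have hM5 : 100000 ≤ M := by norm_num at hM; exact hM
  have hx5 : 100000 ≤ x := hM5.trans hxl
  have hM0 : 0 < M := by linarith
  have hx0 : 0 < x := by linarith
  have hlM : 0 < log M := log_pos (by linarith)
  have hlx : 0 < log x := log_pos (by linarith)
  have hmono : (invLogPoly k).eval (log x)⁻¹ ≤ (invLogPoly k).eval (log M)⁻¹ :=
    eval_invLogPoly_mono k (by positivity) (inv_anti₀ hlM (log_le_log hM0 hxl))
  have hlower : (log M)⁻¹ / (1 + 0.6931471808 * (log M)⁻¹) ≤ (log x)⁻¹ := by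
    have h := log_le_log hx0 hxu
    rw [log_mul (by norm_num) hM0.ne'] at h
    have h2 := log_two_lt_d9
    have h3 : (log M)⁻¹ / (1 + 0.6931471808 * (log M)⁻¹) = (log M + 0.6931471808)⁻¹ := by
      field_simp
    rw [h3]
    exact inv_anti₀ hlx (by linarith)
  have hpoly := two_pow_mul_invLogPoly_lt hk1 hk6 (inv_pos.2 hlM) (inv_log_le hM5)
  have hmono' := eval_invLogPoly_mono k (by positivity) hlower
  obtain ⟨hM1, hM2⟩ := scaled_iteratedDeriv_bounds hL hk1 hk6 hM5
  obtain ⟨hx1, hx2⟩ := scaled_iteratedDeriv_bounds hL hk1 hk6 hx5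
  have hb : 0 < ratioBound k := by unfold ratioBound; split_ifs <;> norm_num
  change _ ∧ _ < ratioBound k
  set f := fun y : ℝ => (log N + log (y - 1)) / log y
  set p := (invLogPoly k).eval (log M)⁻¹
  set q := (invLogPoly k).eval (log x)⁻¹
  have hq : 0 < q := by
    have hp : 0 ≤ p := eval_invLogPoly_nonneg k (by positivity)
    have h1 : 0 < ratioBound k * ((1 - 1 / 10 ^ 7) * (invLogPoly k).eval
      ((log M)⁻¹ / (1 + 0.6931471808 * (log M)⁻¹))) := lt_of_le_of_lt (by positivity) hpoly
    have h2 := pos_of_mul_pos_right h1 hb.le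
    linarith
  have hLq : 0 < log N * q := mul_pos (by linarith) hq
  set A := (-1) ^ k * M ^ k * iteratedDeriv k f M
  set B := (-1) ^ k * x ^ k * iteratedDeriv k f x
  have hB : 0 < B := by linarith
  have hratio : iteratedDeriv k f M / iteratedDeriv k f x = (x / M) ^ k * (A / B) := by
    have hne : iteratedDeriv k f x ≠ 0 := fun h => hB.ne' (by simp [B, h])
    have hs : ((-1 : ℝ) ^ k) ≠ 0 := by simp
    simp only [A, B, div_pow]
    field_simp
  rw [hratio]
  have hLpq : log N * q ≤ log N * p := mul_le_mul_of_nonneg_left hmono (by linarith)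
  constructor
  · have h1 : 1 ≤ (x / M) ^ k := one_le_pow₀ ((one_le_div hM0).2 hxl)
    have h2 : 0.999999 < A / B := by
      rw [lt_div_iff₀ hB]
      linarith
    nlinarith
  · have h1 : (x / M) ^ k ≤ 2 ^ k := by
      gcongr
      rwa [div_le_iff₀ hM0]
    have hA : 0 < A := by linarith
    calc (x / M) ^ k * (A / B) ≤ 2 ^ k * (A / B) := by gcongr
      _ < ratioBound k := by
        rw [← mul_div_assoc, div_lt_iff₀ hB]
        have h3 : 2 ^ k * p < ratioBound k * ((1 - 1 / 10 ^ 7) * q) :=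
          hpoly.trans_le (by gcongr)
        calc 2 ^ k * A ≤ 2 ^ k * (log N * p) := by gcongr
          _ = log N * (2 ^ k * p) := by ring
          _ < log N * (ratioBound k * ((1 - 1 / 10 ^ 7) * q)) := by gcongr
          _ = ratioBound k * ((1 - 1 / 10 ^ 7) * (log N * q)) := by ring
          _ ≤ ratioBound k * B := by gcongr
end

section
/- Let N ≥ 2 be an integer and suppose (x_1, m_1) and (x_2, m_2) are two N-solutions with x_1 < x_2. Then x_2 > (log N)^{0.33479}. -/
/-- For an integer `N ≥ 2`, a pair `(x, m)` with `x ≥ 2`, `m ≥ 2` is an `N`-solution if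
`(x^m - 1)/(x - 1) = 1 + x + ⋯ + x^(m-1) = N`. -/
def IsNSol (N x m : ℕ) : Prop :=
  2 ≤ x ∧ 2 ≤ m ∧ ∑ i ∈ Finset.range m, x ^ i = N
theorem sum_range_le_sum_of_card_le {ι : Type*} [Fintype ι] (N : ℕ) (hN : Fintype.card ι = N)
    (w : ι → ℕ) (hw : ∀ c, w c ≤ N)
    (h : ∀ j < N, (Finset.univ.filter fun c => w c ≤ j).card ≤ j + 1) :
    ∑ j ∈ Finset.range N, j ≤ ∑ c, w c := by
  have h1 : ∀ c, w c = ∑ j ∈ Finset.range N, if j < w c then 1 else 0 := by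
    intro c
    rw [← Finset.card_filter]
    have : (Finset.range N).filter (fun j => j < w c) = Finset.range (w c) := by
      ext j
      have := hw c
      simp only [Finset.mem_filter, Finset.mem_range]
      omega
    rw [this, Finset.card_range]
  rw [Finset.sum_congr rfl fun c _ => h1 c, Finset.sum_comm,
    ← Finset.sum_range_reflect (fun j => j) N]
  refine Finset.sum_le_sum fun j hj => ?_
  rw [Finset.mem_range] at hj
  rw [← Finset.card_filter]
  have h2 := Finset.card_filter_add_card_filter_not (s := (Finset.univ : Finset ι)) (fun c => w c ≤ j)
  have h3 := h j hj
  simp only [not_le, Finset.card_univ, hN] at h2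
  omega

theorem pow_dvd_det_of_expansion {ι : Type*} [Fintype ι] [DecidableEq ι] (q : ℤ)
    (E : Matrix ι ι ℤ) (x : ι → ℕ) (C : ℕ → ι → ℤ)
    (hE : ∀ i c, q ^ Fintype.card ι ∣
      E i c - ∑ h ∈ Finset.range (Fintype.card ι), ((x i).choose h : ℤ) * (q ^ h * C h c)) :
    q ^ (∑ j ∈ Finset.range (Fintype.card ι), j) ∣ E.det := by
  set N := Fintype.card ι with hN
  choose e he using hE
  let P : Fin N ⊕ ι → ι → ℤ := Sum.elim (fun h i => ((x i).choose h : ℤ)) (fun j => Pi.single j 1)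
  let Q : ι → Fin N ⊕ ι → ℤ := fun c => Sum.elim (fun h => q ^ (h : ℕ) * C h c) (fun j => q ^ N * e j c)
  have hrow : E.transpose = fun c => ∑ h, Q c h • P h := by
    ext c i
    have := he i c
    rw [Finset.sum_range] at this
    simp only [Matrix.transpose_apply, Finset.sum_apply, Pi.smul_apply, Fintype.sum_sum_type,
      Q, P, Sum.elim_inl, Sum.elim_inr, smul_eq_mul, Pi.single_apply, mul_ite, mul_one, mul_zero,
      Finset.sum_ite_eq, Finset.mem_univ, if_true]
    rw [sub_eq_iff_eq_add.mp this, add_comm]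
    congr 1
    exact Finset.sum_congr rfl fun h _ => mul_comm _ _
  rw [← Matrix.det_transpose, hrow]
  change _ ∣ (Matrix.detRowAlternating (R := ℤ) (n := ι)).toMultilinearMap (fun c => ∑ h, Q c h • P h)
  rw [MultilinearMap.map_sum]
  refine Finset.dvd_sum fun r _ => ?_
  rw [MultilinearMap.map_smul_univ]
  by_cases hr : Function.Injective r
  · refine Dvd.dvd.mul_right ?_ _
    let w : ι → ℕ := fun c => Sum.elim (fun h : Fin N => (h : ℕ)) (fun _ => N) (r c)
    have hle : ∑ j ∈ Finset.range N, j ≤ ∑ c, w c := by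
      refine sum_range_le_sum_of_card_le N rfl w ?_ ?_
      · intro c
        simp only [w]
        rcases r c with h | h
        · simp
        · simp
      · intro j hj
        rw [← Finset.card_range (j + 1)]
        refine Finset.card_le_card_of_injOn w ?_ ?_
        · intro c hc
          simp only [Finset.coe_filter, Finset.mem_univ, true_and, Set.mem_ofPred_eq] at hc
          simpa using Nat.lt_succ_of_le hc
        · intro c hc d hd hcd
          simp only [Finset.coe_filter, Finset.mem_univ, true_and, Set.mem_ofPred_eq, w] at hc hd hcd
          apply hr
          rcases hc' : r c with h | h <;> rcases hd' : r d with h' | h' <;>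
            simp only [hc', hd', Sum.elim_inl, Sum.elim_inr] at hc hd hcd
          · rw [Fin.ext hcd]
          all_goals omega
    refine (pow_dvd_pow q hle).trans ?_
    rw [← Finset.prod_pow_eq_pow_sum]
    refine Finset.prod_dvd_prod_of_dvd _ _ fun c _ => ?_
    simp only [w, Q]
    rcases r c with h | h
    · exact dvd_mul_right _ _
    · exact dvd_mul_right _ _
  · simp only [Function.Injective, not_forall] at hr
    obtain ⟨c, d, hcd, hne⟩ := hr
    have : Matrix.det (fun c => P (r c)) = 0 := Matrix.det_zero_of_row_eq hne (by rw [hcd])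
    change _ ∣ _ • Matrix.det (fun c => P (r c))
    rw [this, smul_zero]
    exact dvd_zero _

theorem choose_mul_one_add_pow (x k : ℕ) (y : ℤ) (M : ℕ) (hM : x < M) :
    (x.choose k : ℤ) * (1 + y) ^ x =
      ∑ h ∈ Finset.range M, (x.choose h : ℤ) * ((1 + y) ^ k * (h.choose k) * y ^ (h - k)) := by
  rcases lt_or_ge x k with hxk | hxk
  · rw [Nat.choose_eq_zero_of_lt hxk, Nat.cast_zero, zero_mul]
    refine (Finset.sum_eq_zero fun h _ => ?_).symm
    rcases lt_or_ge h k with hk | hk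
    · simp [Nat.choose_eq_zero_of_lt hk]
    · simp [Nat.choose_eq_zero_of_lt (hxk.trans_le hk)]
  · obtain ⟨d, rfl⟩ := Nat.exists_eq_add_of_le hxk
    obtain ⟨M, rfl⟩ := Nat.exists_eq_add_of_le (Nat.succ_le_of_lt hM)
    have h1 : ∑ h ∈ Finset.range ((k + d).succ + M), ((k + d).choose h : ℤ) *
        ((1 + y) ^ k * (h.choose k) * y ^ (h - k)) = ∑ h ∈ Finset.range (k + (d + 1)),
        ((k + d).choose h : ℤ) * ((1 + y) ^ k * (h.choose k) * y ^ (h - k)) := by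
      rw [Finset.sum_range_add]
      simp only [Nat.succ_eq_add_one, add_assoc, add_eq_left]
      refine Finset.sum_eq_zero fun j _ => ?_
      rw [Nat.choose_eq_zero_of_lt (by omega)]
      simp
    rw [h1, Finset.sum_range_add, Finset.sum_eq_zero, zero_add, pow_add, add_comm 1 y, add_pow y 1 d,
      Finset.mul_sum, Finset.mul_sum]
    · refine Finset.sum_congr rfl fun j _ => ?_
      have h2 : (k + d).choose (k + j) * (k + j).choose k = (k + d).choose k * d.choose j := by
        rw [Nat.choose_mul (Nat.le_add_right k j)]
        simp
      have h3 : ((k + d).choose (k + j) : ℤ) * (k + j).choose k = (k + d).choose k * d.choose j := by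
        exact_mod_cast h2
      simp only [Nat.add_sub_cancel_left, one_pow, mul_one]
      linear_combination (-(y + 1) ^ k * y ^ j) * h3
    · intro h hh
      rw [Nat.choose_eq_zero_of_lt (Finset.mem_range.mp hh)]
      simp

theorem exists_expansion_of_modEq_exp (q β c : ℤ) (hβ : q ∣ β - 1) (k N : ℕ) :
    ∃ C : ℕ → ℤ, ∀ (x : ℕ) (y : ℤ), q ^ N ∣ y - c * β ^ x →
      q ^ N ∣ q ^ k * ((x.choose k : ℤ) * y) -
        ∑ h ∈ Finset.range N, (x.choose h : ℤ) * (q ^ h * C h) := by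
  obtain ⟨z, hz⟩ := hβ
  obtain rfl : β = 1 + q * z := by linarith
  refine ⟨fun h => c * (1 + q * z) ^ k * h.choose k * z ^ (h - k), fun x y hy => ?_⟩
  have h1 := choose_mul_one_add_pow x k (q * z) (N + (x + 1)) (by omega)
  have h2 : q ^ k * ((x.choose k : ℤ) * (c * (1 + q * z) ^ x)) =
      ∑ h ∈ Finset.range (N + (x + 1)), (x.choose h : ℤ) *
        (q ^ h * (c * (1 + q * z) ^ k * h.choose k * z ^ (h - k))) := by
    rw [mul_left_comm _ c, h1, Finset.mul_sum, Finset.mul_sum]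
    refine Finset.sum_congr rfl fun h _ => ?_
    rcases lt_or_ge h k with hk | hk
    · simp [Nat.choose_eq_zero_of_lt hk]
    · obtain ⟨d, rfl⟩ := Nat.exists_eq_add_of_le hk
      rw [Nat.add_sub_cancel_left, mul_pow, pow_add]
      ring
  rw [Finset.sum_range_add] at h2
  have h3 : q ^ N ∣ ∑ j ∈ Finset.range (x + 1), (x.choose (N + j) : ℤ) *
        (q ^ (N + j) * (c * (1 + q * z) ^ k * (N + j).choose k * z ^ (N + j - k))) := by
    refine Finset.dvd_sum fun j _ => ?_
    rw [pow_add, mul_assoc (q ^ N)]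
    exact Dvd.dvd.mul_left (dvd_mul_right _ _) _
  have h4 := dvd_add (Dvd.dvd.mul_left hy (q ^ k * (x.choose k : ℤ))) h3
  refine h4.trans (dvd_of_eq ?_)
  linear_combination -h2
open Polynomial in
theorem det_comp_vandermonde_ne_zero {n : ℕ} (p : Fin n → ℚ[X]) (hp : ∀ j, p j ≠ 0) (t : ℚ)
    (b : Fin n → ℚ) (hb : Function.Injective b) :
    (Matrix.of fun j i : Fin n => (taylor ((i : ℕ) * t) (p j)) * C (b j ^ (i : ℕ))).det ≠ 0 := by
  intro h0
  have h1 := congrArg (fun P => P.coeff (∑ j, (p j).natDegree)) h0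
  simp only [Matrix.det_apply, finsetSum_coeff, coeff_smul, Matrix.of_apply, coeff_zero,
    Finset.prod_mul_distrib] at h1
  have h2 : ∀ σ : Equiv.Perm (Fin n),
      ((∏ i : Fin n, taylor ((i : ℕ) * t) (p (σ i))) * ∏ i : Fin n, C (b (σ i) ^ (i : ℕ))).coeff
        (∑ j, (p j).natDegree) = (∏ j, (p j).leadingCoeff) * ∏ i : Fin n, b (σ i) ^ (i : ℕ) := by
    intro σ
    rw [← map_prod, coeff_mul_C]
    congr 1
    have hne : ∀ i ∈ Finset.univ, taylor (((i : Fin n) : ℕ) * t) (p (σ i)) ≠ 0 := fun i _ => by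
      simpa using hp (σ i)
    have h3 : (∏ i : Fin n, taylor ((i : ℕ) * t) (p (σ i))).natDegree = ∑ j, (p j).natDegree := by
      rw [natDegree_prod _ _ hne, ← Equiv.sum_comp σ (fun j => (p j).natDegree)]
      simp
    rw [← h3, coeff_natDegree, leadingCoeff_prod, ← Equiv.prod_comp σ (fun j => (p j).leadingCoeff)]
    simp
  simp only [h2] at h1
  have h4 : (Matrix.vandermonde b).det * ∏ j, (p j).leadingCoeff = 0 := by
    rw [← h1, Matrix.det_apply, Finset.sum_mul]
    refine Finset.sum_congr rfl fun σ _ => ?_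
    rw [smul_mul_assoc, mul_comm]
    rfl
  rcases mul_eq_zero.mp h4 with h | h
  · exact Matrix.det_vandermonde_ne_zero_iff.mpr hb h
  · rw [Finset.prod_eq_zero_iff] at h
    obtain ⟨j, _, hj⟩ := h
    exact hp j (leadingCoeff_eq_zero.mp hj)

open Polynomial in
theorem polynomials_eq_zero_of_exp_sum_eq_zero {K L : ℕ} (p : Fin L → ℚ[X])
    (hp : ∀ l, (p l).natDegree ≤ K) (t β : ℚ) (hβ : 0 < β) (hβ1 : β ≠ 1) (s : Finset ℚ)
    (hs : K * L < s.card) (y : ℚ → ℚ) (hy : ∀ x ∈ s, y x ≠ 0)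
    (h : ∀ x ∈ s, ∀ i < L, ∑ l, (p l).eval (x + i * t) * (y x * β ^ i) ^ (l : ℕ) = 0) :
    ∀ l, p l = 0 := by
  by_contra! hne
  set A := Finset.univ.filter fun l => p l ≠ 0 with hA
  set n := A.card with hn
  let e : Fin n ≃o A := A.orderIsoOfFin rfl
  have hApos : 0 < n := by
    obtain ⟨l, hl⟩ := hne
    exact Finset.card_pos.mpr ⟨l, by simp [hA, hl]⟩
  have hnL : n ≤ L := by simpa using Finset.card_le_univ A
  let q : Fin n → ℚ[X] := fun j => p (e j)
  let b : Fin n → ℚ := fun j => β ^ ((e j : Fin L) : ℕ)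
  have hq : ∀ j, q j ≠ 0 := fun j => (Finset.mem_filter.mp (e j).2).2
  have hb : Function.Injective b := by
    intro i j hij
    have := pow_right_injective₀ hβ hβ1 hij
    exact e.injective (Subtype.ext (Fin.ext this))
  set M := (Matrix.of fun j i : Fin n => (taylor ((i : ℕ) * t) (q j)) * C (b j ^ (i : ℕ))) with hM
  have hdet := det_comp_vandermonde_ne_zero q hq t b hb
  rw [← hM] at hdet
  have hroot : ∀ x ∈ s, M.det.IsRoot x := by
    intro x hx
    rw [IsRoot, ← coe_evalRingHom, RingHom.map_det]
    refine Matrix.exists_vecMul_eq_zero_iff.mp ⟨fun j => y x ^ ((e j : Fin L) : ℕ), ?_, ?_⟩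
    · intro h0
      exact pow_ne_zero _ (hy x hx) (congrFun h0 ⟨0, hApos⟩)
    · ext i
      have hi := h x hx i (i.2.trans_le hnL)
      have : ∑ l, (p l).eval (x + (i : ℕ) * t) * (y x * β ^ (i : ℕ)) ^ (l : ℕ) =
          ∑ l ∈ A, (p l).eval (x + (i : ℕ) * t) * (y x * β ^ (i : ℕ)) ^ (l : ℕ) := by
        refine (Finset.sum_subset (Finset.subset_univ A) fun l _ hl => ?_).symm
        have : p l = 0 := by simpa [hA] using hl
        simp [this]
      rw [this, ← Finset.sum_coe_sort, ← Equiv.sum_comp e.toEquiv] at hi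
      rw [Matrix.vecMul, dotProduct, Pi.zero_apply, ← hi]
      refine Finset.sum_congr rfl fun j _ => ?_
      simp only [hM, q, b, RingHom.mapMatrix_apply, Matrix.map_apply, Matrix.of_apply,
        coe_evalRingHom, eval_mul, eval_C, taylor_eval, RelIso.coe_fn_toEquiv]
      rw [mul_pow, ← pow_mul, ← pow_mul, mul_comm (i : ℕ)]
      ring
  have hdeg : M.det.natDegree ≤ n * K := by
    rw [Matrix.det_apply]
    refine natDegree_sum_le_of_forall_le _ _ fun σ _ => ?_
    refine (natDegree_smul_le _ _).trans ((natDegree_prod_le _ _).trans ?_)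
    refine (Finset.sum_le_card_nsmul _ _ K fun i _ => ?_).trans (by simp)
    simp only [hM, Matrix.of_apply]
    refine (natDegree_mul_C_le _ _).trans ?_
    rw [natDegree_taylor]
    exact hp _
  have hcard : s.card ≤ M.det.natDegree := by
    refine (Finset.card_le_card (t := M.det.roots.toFinset) fun x hx => ?_).trans
      ((Multiset.toFinset_card_le _).trans (card_roots' _))
    rw [Multiset.mem_toFinset, mem_roots hdet]
    exact hroot x hx
  have := Nat.mul_le_mul_right K hnL
  rw [mul_comm] at hs
  omega

theorem exists_submatrix_det_ne_zero {F m n : Type*} [Field F] [Fintype m] [Fintype n] [DecidableEq n]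
    (A : Matrix m n F) (hA : ∀ v, A.mulVec v = 0 → v = 0) :
    ∃ f : n → m, (A.submatrix f id).det ≠ 0 := by
  have hspan : Submodule.span F (Set.range A) = ⊤ := by
    by_contra hne
    obtain ⟨φ, hφ, hle⟩ := Submodule.exists_le_ker_of_lt_top _ (lt_top_iff_ne_top.mpr hne)
    apply hφ
    have h1 : ∀ w, φ w = w ⬝ᵥ (fun j => φ (Pi.single j 1)) := by
      intro w
      conv_lhs => rw [pi_eq_sum_univ' w]
      simp [dotProduct]
    have h2 := hA (fun j => φ (Pi.single j 1)) (by
      ext i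
      rw [Matrix.mulVec, ← h1]
      exact hle (Submodule.subset_span ⟨i, rfl⟩))
    ext w
    simp [congrFun h2]
  obtain ⟨κ, a, _, hsp, hli⟩ := exists_linearIndependent' F A
  rw [hspan] at hsp
  let B := Module.Basis.mk hli hsp.ge
  let e : n ≃ κ := (Pi.basisFun F n).indexEquiv B
  refine ⟨a ∘ e, ?_⟩
  have : LinearIndependent F (A.submatrix (a ∘ e) id).row := hli.comp e e.injective
  exact ((Matrix.isUnit_iff_isUnit_det _).mp
    (Matrix.linearIndependent_rows_iff_isUnit.mp this)).ne_zero

theorem abs_det_le_factorial_mul_prod {ι : Type*} [Fintype ι] [DecidableEq ι] (E : Matrix ι ι ℤ)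
    (B : ι → ℤ) (hB : ∀ i c, |E i c| ≤ B c) :
    |E.det| ≤ (Fintype.card ι).factorial * ∏ c, B c := by
  rw [← Matrix.det_transpose, Matrix.det_apply]
  refine (Finset.abs_sum_le_sum_abs _ _).trans ?_
  refine (Finset.sum_le_card_nsmul _ _ (∏ c, B c) fun σ _ => ?_).trans ?_
  · have : |Equiv.Perm.sign σ • ∏ i, E.transpose (σ i) i| = ∏ i, |E i (σ i)| := by
      rw [Units.smul_def, smul_eq_mul, abs_mul, Finset.abs_prod]
      simp
    rw [this, ← Equiv.prod_comp σ B]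
    exact Finset.prod_le_prod (fun _ _ => abs_nonneg _) fun i _ => hB _ _
  · rw [Finset.card_univ, Fintype.card_perm, nsmul_eq_mul]

theorem sum_dist_center (H : ℕ) :
    ∑ l : Fin (2 * H + 1), (((l : ℕ) - H) + (H - (l : ℕ))) = H * (H + 1) := by
  rw [Fin.sum_univ_eq_sum_range (fun l => (l - H) + (H - l)) (2 * H + 1),
    show 2 * H + 1 = H + (H + 1) by ring, Finset.sum_range_add]
  have h1 : ∑ x ∈ Finset.range H, ((x - H) + (H - x)) = ∑ x ∈ Finset.range H, (x + 1) := by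
    rw [← Finset.sum_range_reflect]
    refine Finset.sum_congr rfl fun x hx => ?_
    rw [Finset.mem_range] at hx
    omega
  have h2 : ∑ x ∈ Finset.range (H + 1), ((H + x - H) + (H - (H + x))) =
      ∑ x ∈ Finset.range (H + 1), x :=
    Finset.sum_congr rfl fun x _ => by omega
  have h3 := Finset.sum_range_id_mul_two (H + 1)
  rw [h1, h2, ← Finset.sum_range_succ' (fun x => x) H |>.trans (add_zero _), ← mul_two, h3]
  simp [mul_comm]

theorem eq_zero_of_sum_choose_eq_zero {K : ℕ} (a : Fin K → ℚ)
    (h : ∀ x : ℕ, ∑ k, a k * (x.choose k : ℚ) = 0) : ∀ k, a k = 0 := by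
  have key : ∀ n : ℕ, ∀ k : Fin K, (k : ℕ) = n → a k = 0 := by
    intro n
    induction n using Nat.strong_induction_on with
    | _ n ih =>
      rintro k rfl
      have h1 := h k
      rw [Finset.sum_eq_single k] at h1
      · simpa using h1
      · intro j _ hj
        rcases lt_or_gt_of_ne hj with hlt | hlt
        · rw [ih j hlt j rfl, zero_mul]
        · rw [Nat.choose_eq_zero_of_lt (by exact_mod_cast hlt)]
          simp
      · simp
  exact fun k => key k k rfl

open Polynomial in
theorem exists_polynomial_eval_eq_choose (k : ℕ) :
    ∃ P : ℚ[X], P.natDegree ≤ k ∧ ∀ x : ℕ, P.eval (x : ℚ) = x.choose k := by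
  refine ⟨descPochhammer ℚ k * C ((k.factorial : ℚ)⁻¹), ?_, fun x => ?_⟩
  · exact (natDegree_mul_C_le _ _).trans (descPochhammer_natDegree ℚ k).le
  · rw [eval_mul, eval_C, descPochhammer_eval_eq_descFactorial, Nat.choose_eq_descFactorial_div_factorial,
      Nat.cast_div (Nat.factorial_dvd_descFactorial x k) (by exact_mod_cast Nat.factorial_ne_zero k)]
    rfl

open Polynomial in
theorem choose_mul_exp_linearIndependent {K L R S t : ℕ} (α β : ℚ) (hα : α ≠ 0) (hβ : 0 < β)
    (hβ1 : β ≠ 1) (hRt : R ≤ t) (hRS : (K - 1) * L < R * S)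
    (a : Fin K × Fin L → ℚ)
    (h : ∀ r < R, ∀ s, s < S + (L - 1) →
      ∑ c : Fin K × Fin L, a c * (((r + s * t).choose c.1 : ℚ) * (α ^ r * β ^ s) ^ (c.2 : ℕ)) = 0) :
    a = 0 := by
  choose P hPdeg hPeval using exists_polynomial_eval_eq_choose
  let p : Fin L → ℚ[X] := fun l => ∑ k : Fin K, C (a (k, l)) * P k
  let g : Fin R × Fin S → ℚ := fun z => ((z.1 + z.2 * t : ℕ) : ℚ)
  have hdm : ∀ z : Fin R × Fin S, ((z.1 : ℕ) + z.2 * t) % t = z.1 ∧ ((z.1 : ℕ) + z.2 * t) / t = z.2 := by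
    intro z
    have h1 := z.1.2
    have ht : 0 < t := by omega
    rw [Nat.add_mul_mod_self_right, Nat.add_mul_div_right _ _ ht, Nat.mod_eq_of_lt (by omega),
      Nat.div_eq_of_lt (by omega)]
    simp
  have hg : Function.Injective g := by
    intro z z' hz
    have hz' : (z.1 : ℕ) + z.2 * t = z'.1 + z'.2 * t := Nat.cast_injective (R := ℚ) hz
    have h1 := hdm z
    have h2 := hdm z'
    rw [hz'] at h1
    exact Prod.ext (Fin.ext (h1.1.symm.trans h2.1)) (Fin.ext (h1.2.symm.trans h2.2))
  have hp := polynomials_eq_zero_of_exp_sum_eq_zero (K := K - 1) p ?_ t β hβ hβ1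
    (Finset.univ.image g) ?_ (fun x => α ^ (⌊x⌋₊ % t) * β ^ (⌊x⌋₊ / t)) ?_ ?_
  · ext ⟨k, l⟩
    refine eq_zero_of_sum_choose_eq_zero (fun k => a (k, l)) (fun x => ?_) k
    have := congrArg (eval (x : ℚ)) (hp l)
    simpa [p, eval_finsetSum, hPeval] using this
  · intro l
    refine natDegree_sum_le_of_forall_le _ _ fun k _ => ?_
    have h1 := k.2
    exact (natDegree_C_mul_le _ _).trans ((hPdeg k).trans (by omega))
  · rw [Finset.card_image_of_injective _ hg]
    simpa using hRS
  · intro x _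
    positivity
  · intro x hx i hi
    obtain ⟨z, _, rfl⟩ := Finset.mem_image.mp hx
    have h1 := h z.1 z.1.2 (z.2 + i) (by have := z.2.2; omega)
    rw [Fintype.sum_prod_type_right] at h1
    rw [← h1]
    refine Finset.sum_congr rfl fun l _ => ?_
    simp only [g, Nat.floor_natCast, (hdm z).1, (hdm z).2, p, eval_finsetSum, eval_mul, eval_C]
    rw [Finset.sum_mul]
    refine Finset.sum_congr rfl fun k _ => ?_
    have h2 : (((z.1 : ℕ) + z.2 * t : ℕ) : ℚ) + i * t = ((z.1 + (z.2 + i) * t : ℕ) : ℚ) := by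
      push_cast
      ring
    rw [h2, hPeval, pow_add β]
    ring

theorem exists_inverse_modEq_one (q α : ℤ) (hα : q ∣ α - 1) (N : ℕ) (hN : 0 < N) :
    ∃ γ : ℤ, q ∣ γ - 1 ∧ q ^ N ∣ α * γ - 1 := by
  obtain ⟨z, hz⟩ := hα
  have h1 : IsCoprime α (q ^ N) := by
    refine IsCoprime.pow_right ⟨1, -z, ?_⟩
    linear_combination hz
  obtain ⟨γ, d, h⟩ := h1
  refine ⟨γ, ?_, ⟨-d, by linear_combination h⟩⟩
  obtain ⟨M, rfl⟩ := Nat.exists_eq_succ_of_ne_zero hN.ne'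
  exact ⟨-z * γ - d * q ^ M, by rw [pow_succ] at h; linear_combination h - γ * hz⟩

theorem interpolation_determinant_bound {q α u v t n K H R S : ℕ} (hq : 1 ≤ q)
    (hα : (q : ℤ) ∣ (α : ℤ) - 1) (hα0 : 1 ≤ α) (hu : 1 ≤ u) (huv : u < v)
    (hn : (q : ℤ) ^ n ∣ (u : ℤ) - v * α ^ t) (hK : 1 ≤ K) (hNn : K * (2 * H + 1) ≤ n)
    (hR : 1 ≤ R) (hRt : R ≤ t) (hS : 2 * H < S)
    (hRS : (K - 1) * (2 * H + 1) < R * (S - 2 * H)) :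
    q ^ (∑ j ∈ Finset.range (K * (2 * H + 1)), j) ≤
      (q ^ (∑ k ∈ Finset.range K, k)) ^ (2 * H + 1) * ((K * (2 * H + 1)).factorial *
        ((∏ k ∈ Finset.range K, ((R - 1) + (S - 1) * t).choose k) ^ (2 * H + 1) *
          ((α ^ (R - 1) * v ^ (S - 1)) ^ (H * (H + 1))) ^ K)) := by
  set L := 2 * H + 1 with hL
  set X := (R - 1) + (S - 1) * t with hX
  set W := α ^ (R - 1) * v ^ (S - 1) with hW
  let x : Fin R × Fin S → ℕ := fun i => i.1 + i.2 * t
  let w : Fin R × Fin S → ℕ := fun i => α ^ (i.1 : ℕ) * u ^ (i.2 : ℕ) * v ^ (S - 1 - i.2)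
  let w' : Fin R × Fin S → ℕ := fun i => α ^ (R - 1 - i.1) * u ^ (S - 1 - i.2) * v ^ (i.2 : ℕ)
  let e : Fin L → ℕ := fun l => ((l : ℕ) - H) + (H - l)
  let y : Fin R × Fin S → Fin L → ℕ := fun i l => if H ≤ l then w i ^ e l else w' i ^ e l
  have hxX : ∀ i, x i ≤ X := fun i => by
    have h1 := i.1.2
    have h2 := i.2.2
    exact Nat.add_le_add (by omega) (Nat.mul_le_mul_right _ (by omega))
  have hwW : ∀ i, w i ≤ W := fun i => by
    have h1 := i.1.2
    have h2 := i.2.2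
    calc w i ≤ α ^ (R - 1) * v ^ (i.2 : ℕ) * v ^ (S - 1 - i.2) := by
          refine Nat.mul_le_mul_right _ (Nat.mul_le_mul ?_ (Nat.pow_le_pow_left huv.le _))
          exact Nat.pow_le_pow_right hα0 (by omega)
      _ = W := by rw [mul_assoc, ← pow_add, show (i.2 : ℕ) + (S - 1 - i.2) = S - 1 by omega]
  have hwW' : ∀ i, w' i ≤ W := fun i => by
    have h1 := i.1.2
    have h2 := i.2.2
    calc w' i ≤ α ^ (R - 1) * v ^ (S - 1 - i.2) * v ^ (i.2 : ℕ) := by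
          refine Nat.mul_le_mul_right _ (Nat.mul_le_mul ?_ (Nat.pow_le_pow_left huv.le _))
          exact Nat.pow_le_pow_right hα0 (by omega)
      _ = W := by rw [mul_assoc, ← pow_add, show S - 1 - (i.2 : ℕ) + i.2 = S - 1 by omega]
  have hyW : ∀ i l, y i l ≤ W ^ e l := fun i l => by
    simp only [y]
    split_ifs
    · exact Nat.pow_le_pow_left (hwW i) _
    · exact Nat.pow_le_pow_left (hwW' i) _
  let A : Matrix (Fin R × Fin S) (Fin K × Fin L) ℤ :=
    Matrix.of fun i c => ((x i).choose c.1 : ℤ) * y i c.2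
  have hα' : (α : ℚ) ≠ 0 := by positivity
  have hv' : (v : ℚ) ≠ 0 := by
    have : 0 < v := by omega
    positivity
  have hu' : (u : ℚ) ≠ 0 := by positivity
  have hind : ∀ a, (A.map ((↑) : ℤ → ℚ)).mulVec a = 0 → a = 0 := by
    intro a ha
    let d : Fin L → ℚ := fun l => if H ≤ l then ((v : ℚ) ^ (S - 1)) ^ e l else
      ((α : ℚ) ^ (R - 1) * u ^ (S - 1)) ^ e l
    have hd : ∀ l, d l ≠ 0 := fun l => by
      simp only [d]
      split_ifs <;> positivity
    have h0 := choose_mul_exp_linearIndependent (K := K) (L := L) (R := R) (S := S - 2 * H) (t := t)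
      (α : ℚ) (u / v : ℚ) hα' (by positivity)
      (by rw [Ne, div_eq_one_iff_eq hv']; exact_mod_cast huv.ne) hRt hRS
      (fun c => a c * d c.2) ?_
    · ext c
      have := congrFun h0 c
      simpa [hd] using this
    · intro r hr s hs
      have hs' : s < S := by omega
      have h1 := congrFun ha (⟨r, hr⟩, ⟨s, hs'⟩)
      rw [Matrix.mulVec, dotProduct, Pi.zero_apply] at h1
      set Y : ℚ := (α : ℚ) ^ r * (u / v) ^ s with hY
      rw [← mul_zero (Y ^ H), ← h1, Finset.mul_sum]
      refine Finset.sum_congr rfl fun c _ => ?_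
      simp only [Matrix.map_apply, Matrix.of_apply, A, x, y, d]
      have hYw : ((w (⟨r, hr⟩, ⟨s, hs'⟩) : ℕ) : ℚ) = v ^ (S - 1) * Y := by
        simp only [w, hY]
        push_cast
        rw [div_pow, show S - 1 = (S - 1 - s) + s by omega, pow_add, Nat.add_sub_cancel]
        field_simp
      have hYw' : Y * ((w' (⟨r, hr⟩, ⟨s, hs'⟩) : ℕ) : ℚ) = α ^ (R - 1) * u ^ (S - 1) := by
        simp only [w', hY]
        push_cast
        rw [div_pow]
        conv_rhs => rw [show S - 1 = (S - 1 - s) + s by omega, show R - 1 = (R - 1 - r) + r by omega,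
          pow_add, pow_add]
        field_simp
      split_ifs with hH
      · have he : (c.2 : ℕ) = H + e c.2 := by simp only [e]; omega
        push_cast
        rw [hYw]
        conv_lhs => rw [he]
        rw [pow_add, mul_pow]
        ring
      · have he : H = c.2 + e c.2 := by simp only [e]; omega
        push_cast
        rw [← hYw']
        conv_rhs => rw [he]
        rw [pow_add, mul_pow]
        ring
  obtain ⟨f, hf⟩ := exists_submatrix_det_ne_zero _ hind
  let E : Matrix (Fin K × Fin L) (Fin K × Fin L) ℤ := A.submatrix f id
  have hE0 : E.det ≠ 0 := by
    intro h0
    apply hf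
    rw [Matrix.submatrix_map, ← Int.cast_det]
    exact_mod_cast h0
  have hcard : Fintype.card (Fin K × Fin L) = K * L := by simp
  have hexp : ∀ c : Fin K × Fin L, ∃ C : ℕ → ℤ, ∀ i, (q : ℤ) ^ (K * L) ∣
      (q : ℤ) ^ (c.1 : ℕ) * A i c -
        ∑ h ∈ Finset.range (K * L), ((x i).choose h : ℤ) * ((q : ℤ) ^ h * C h) := by
    intro c
    have hn' : (u : ℤ) ≡ v * α ^ t [ZMOD (q : ℤ) ^ (K * L)] :=
      (Int.modEq_iff_dvd.mpr ((pow_dvd_pow _ hNn).trans hn)).symm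
    have hdvd : ∀ (γ : ℤ) (m : ℕ), (q : ℤ) ∣ γ - 1 → (q : ℤ) ∣ γ ^ m - 1 := fun γ m h =>
      h.trans (by simpa using sub_dvd_pow_sub_pow γ 1 m)
    by_cases hH : H ≤ c.2
    · obtain ⟨C, hC⟩ := exists_expansion_of_modEq_exp q ((α : ℤ) ^ e c.2)
        (((v : ℤ) ^ (S - 1)) ^ e c.2) (hdvd _ _ hα) c.1 (K * L)
      refine ⟨C, fun i => ?_⟩
      simp only [A, Matrix.of_apply]
      refine hC (x i) _ ?_
      have h2 := i.2.2
      have h3 : ((w i : ℕ) : ℤ) ≡ v ^ (S - 1) * α ^ x i [ZMOD (q : ℤ) ^ (K * L)] := by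
        simp only [w]
        push_cast
        calc (α : ℤ) ^ (i.1 : ℕ) * u ^ (i.2 : ℕ) * v ^ (S - 1 - i.2)
            ≡ α ^ (i.1 : ℕ) * (v * α ^ t) ^ (i.2 : ℕ) * v ^ (S - 1 - i.2) [ZMOD (q : ℤ) ^ (K * L)] :=
              ((hn'.pow _).mul_left _).mul_right _
          _ = v ^ (S - 1) * α ^ x i := by
              conv_rhs => rw [show S - 1 = (S - 1 - i.2) + i.2 by omega]
              simp only [x, mul_pow, pow_add, ← pow_mul, mul_comm t]
              ring
      have h4 := (h3.pow (e c.2)).symm.dvd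
      simp only [y, if_pos hH]
      rw [mul_pow, ← pow_mul (α : ℤ), mul_comm (x i), pow_mul (α : ℤ)] at h4
      exact_mod_cast h4
    · have hN : 0 < K * L := by positivity
      obtain ⟨γ, hγ, hαγ⟩ := exists_inverse_modEq_one q α hα (K * L) hN
      obtain ⟨C, hC⟩ := exists_expansion_of_modEq_exp q (γ ^ e c.2)
        (((v : ℤ) ^ (S - 1) * α ^ X) ^ e c.2) (hdvd _ _ hγ) c.1 (K * L)
      refine ⟨C, fun i => ?_⟩
      simp only [A, Matrix.of_apply]
      refine hC (x i) _ ?_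
      have h1 := i.1.2
      have h2 := i.2.2
      have hγ' : (1 : ℤ) ≡ α * γ [ZMOD (q : ℤ) ^ (K * L)] := Int.modEq_iff_dvd.mpr hαγ
      have hxx : R - 1 - i.1 + t * (S - 1 - i.2) + x i = X := by
        obtain ⟨a, ha⟩ := Nat.exists_eq_add_of_le (show (i.1 : ℕ) ≤ R - 1 by omega)
        obtain ⟨b, hb⟩ := Nat.exists_eq_add_of_le (show (i.2 : ℕ) ≤ S - 1 by omega)
        simp only [hX, x, ha, hb, Nat.add_sub_cancel_left]
        ring
      have h3 : ((w' i : ℕ) : ℤ) ≡ v ^ (S - 1) * α ^ X * γ ^ x i [ZMOD (q : ℤ) ^ (K * L)] := by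
        simp only [w']
        push_cast
        calc (α : ℤ) ^ (R - 1 - i.1) * u ^ (S - 1 - i.2) * v ^ (i.2 : ℕ)
            ≡ α ^ (R - 1 - i.1) * (v * α ^ t) ^ (S - 1 - i.2) * v ^ (i.2 : ℕ)
              [ZMOD (q : ℤ) ^ (K * L)] := ((hn'.pow _).mul_left _).mul_right _
          _ = v ^ (S - 1) * α ^ (R - 1 - i.1 + t * (S - 1 - i.2)) * 1 ^ x i := by
              conv_rhs => rw [show S - 1 = (S - 1 - i.2) + i.2 by omega]
              simp only [mul_pow, pow_add, ← pow_mul, Nat.add_sub_cancel]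
              ring
          _ ≡ v ^ (S - 1) * α ^ (R - 1 - i.1 + t * (S - 1 - i.2)) * (α * γ) ^ x i
              [ZMOD (q : ℤ) ^ (K * L)] := (hγ'.pow _).mul_left _
          _ = v ^ (S - 1) * α ^ X * γ ^ x i := by
              rw [← hxx, mul_pow, pow_add _ _ (x i)]
              ring
      have h4 := (h3.pow (e c.2)).symm.dvd
      simp only [y, if_neg hH]
      rw [mul_pow, ← pow_mul γ, mul_comm (x i), pow_mul γ] at h4
      exact_mod_cast h4
  choose C hC using hexp
  have hdvd := pow_dvd_det_of_expansion (q : ℤ)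
    (Matrix.of fun i c => (q : ℤ) ^ (c.1 : ℕ) * E i c) (fun i => x (f i)) (fun h c => C c h)
    (by rw [hcard]; exact fun i c => hC c (f i))
  rw [Matrix.det_mul_row, hcard] at hdvd
  have hprod : ∏ c : Fin K × Fin L, (q : ℤ) ^ (c.1 : ℕ) = (q ^ (∑ k ∈ Finset.range K, k)) ^ L := by
    rw [Fintype.prod_prod_type]
    simp only [Finset.prod_const, Finset.card_univ, Fintype.card_fin]
    rw [Finset.prod_pow, Finset.prod_pow_eq_pow_sum, Fin.sum_univ_eq_sum_range (fun k => k)]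
  have hbound := abs_det_le_factorial_mul_prod E
    (fun c => ((X.choose c.1 * W ^ e c.2 : ℕ) : ℤ)) (fun i c => by
      simp only [E, A, Matrix.submatrix_apply, Matrix.of_apply, id]
      rw [abs_of_nonneg (by positivity)]
      exact_mod_cast Nat.mul_le_mul (Nat.choose_le_choose _ (hxX _)) (hyW _ _))
  have hprod2 : ∏ c : Fin K × Fin L, (X.choose c.1 * W ^ e c.2) =
      (∏ k ∈ Finset.range K, X.choose k) ^ L * (W ^ (H * (H + 1))) ^ K := by
    rw [Finset.prod_mul_distrib, Fintype.prod_prod_type, Fintype.prod_prod_type]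
    simp only [Finset.prod_const, Finset.card_univ, Fintype.card_fin]
    rw [Finset.prod_pow, Fin.prod_univ_eq_prod_range (fun k => X.choose k), Finset.prod_pow_eq_pow_sum,
      sum_dist_center]
  rw [hcard, ← Nat.cast_prod, hprod2] at hbound
  have hfin := Int.le_of_dvd (by positivity) ((dvd_abs _ _).mpr hdvd)
  rw [hprod, abs_mul, abs_of_nonneg (by positivity)] at hfin
  have hq0 : (0 : ℤ) ≤ (q ^ (∑ k ∈ Finset.range K, k)) ^ L := by positivity
  exact_mod_cast hfin.trans (mul_le_mul_of_nonneg_left hbound hq0)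

theorem mul_log_sub_le_log_factorial {n : ℕ} (hn : 1 ≤ n) :
    n * Real.log n - n + 1 / 2 ≤ Real.log n.factorial := by
  have hn0 : (0 : ℝ) < n := by exact_mod_cast hn
  have hn1 : (1 : ℝ) ≤ n := by exact_mod_cast hn
  have h1 := Real.log_le_log (by positivity) (Stirling.le_factorial_stirling n)
  have h2 : 1 ≤ Real.log (2 * Real.pi * n) := by
    rw [Real.le_log_iff_exp_le (by positivity)]
    have := Real.exp_one_lt_d9
    have := Real.pi_gt_three
    nlinarith
  rw [Real.log_mul (by positivity) (by positivity), Real.log_sqrt (by positivity), Real.log_pow,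
    Real.log_div hn0.ne' (Real.exp_pos 1).ne', Real.log_exp] at h1
  linarith

theorem le_sum_log_factorial (K : ℕ) :
    K * (K - 1) / 2 * (Real.log K - 3 / 2) ≤
      ∑ k ∈ Finset.range K, Real.log k.factorial := by
  induction K with
  | zero => simp
  | succ K ih =>
    rw [Finset.sum_range_succ]
    rcases Nat.eq_zero_or_pos K with rfl | hK
    · simp
    have hK0 : (0 : ℝ) < K := by exact_mod_cast hK
    have h1 := mul_log_sub_le_log_factorial hK
    have h2 : Real.log (K + 1) ≤ Real.log K + 1 / K := by
      have h3 := Real.log_le_sub_one_of_pos (x := ((K : ℝ) + 1) / K) (by positivity)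
      rw [Real.log_div (by positivity) hK0.ne', add_div, div_self hK0.ne'] at h3
      linarith
    have h4 : (K : ℝ) * (K + 1) / 2 * Real.log (K + 1) ≤
        K * (K + 1) / 2 * Real.log K + (K + 1) / 2 :=
      (mul_le_mul_of_nonneg_left h2 (by positivity)).trans_eq (by field_simp)
    push_cast
    linarith

theorem log_prod_choose_le {X K : ℕ} (hX : 1 ≤ X) :
    ∃ P : ℝ, 0 < P ∧ ((∏ k ∈ Finset.range K, X.choose k : ℕ) : ℝ) ≤ P ∧
      Real.log P ≤ K * (K - 1) / 2 * (Real.log X - Real.log K + 3 / 2) := by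
  have hX0 : (0 : ℝ) < X := by exact_mod_cast hX
  refine ⟨∏ k ∈ Finset.range K, ((X : ℝ) ^ k / k.factorial), Finset.prod_pos fun k _ => by positivity,
    ?_, ?_⟩
  · push_cast
    exact Finset.prod_le_prod (fun _ _ => by positivity) fun k _ => Nat.choose_le_pow_div k X
  · rw [Real.log_prod (fun k _ => by positivity)]
    have h1 : ∀ k ∈ Finset.range K, Real.log ((X : ℝ) ^ k / k.factorial) =
        k * Real.log X - Real.log k.factorial := fun k _ => by
      rw [Real.log_div (by positivity) (by positivity), Real.log_pow]
    have h2 : ∑ k ∈ Finset.range K, (k : ℝ) = K * (K - 1) / 2 := by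
      clear h1
      induction K with
      | zero => simp
      | succ K ih => rw [Finset.sum_range_succ, ih]; push_cast; ring
    rw [Finset.sum_congr rfl h1, Finset.sum_sub_distrib, ← Finset.sum_mul, h2]
    linarith [le_sum_log_factorial K]

theorem log_factorial_le (N : ℕ) : Real.log N.factorial ≤ N * Real.log N := by
  rw [← Real.log_pow]
  exact Real.log_le_log (by positivity) (by exact_mod_cast Nat.factorial_le_pow N)

theorem sum_range_cast (K : ℕ) : ((∑ k ∈ Finset.range K, k : ℕ) : ℝ) = K * (K - 1) / 2 := by
  induction K with
  | zero => simp
  | succ K ih => rw [Finset.sum_range_succ, Nat.cast_add, ih]; push_cast; ring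

theorem exp_two_le : Real.exp 2 ≤ 7.39 := by
  rw [show (2 : ℝ) = 1 + 1 by norm_num, Real.exp_add]
  have := Real.exp_one_lt_d9
  have := Real.exp_pos 1
  nlinarith

set_option maxHeartbeats 1000000 in
theorem not_dvd_sub_mul_pow {q α u v t n H : ℕ} (hq : 3 ≤ q)
    (hα : (q : ℤ) ∣ (α : ℤ) - 1) (hqα : q ≤ α) (hu : 1 ≤ u) (huv : u < v) (hqv : q ≤ v)
    (hvq : v ≤ q ^ 2) (htn : t * Real.log α ≤ n * Real.log q)
    (hH : 1 ≤ H) (hHt : Real.log (5 * t) ≤ H * Real.log q)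
    (ht : 48 * H ^ 2 + 98 * H + 55 ≤ t) : ¬ (q : ℤ) ^ n ∣ (u : ℤ) - v * α ^ t := by
  intro hn
  have hq0 : (0 : ℝ) < q := by exact_mod_cast (by omega : 0 < q)
  have hα0 : (0 : ℝ) < α := by exact_mod_cast (by omega : 0 < α)
  have hv0 : (0 : ℝ) < v := by exact_mod_cast (by omega : 0 < v)
  obtain ⟨lam, hlam⟩ : ∃ x, x = Real.log q := ⟨_, rfl⟩
  have hlam0 : 0 < lam := hlam ▸ Real.log_pos (by exact_mod_cast (by omega : 1 < q))
  obtain ⟨g, hg⟩ : ∃ x, x = Real.log α / lam := ⟨_, rfl⟩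
  obtain ⟨β, hβ⟩ : ∃ x, x = Real.log v / lam := ⟨_, rfl⟩
  have hg' : Real.log α = g * lam := by rw [hg]; field_simp
  have hβ' : Real.log v = β * lam := by rw [hβ]; field_simp
  have hg1 : 1 ≤ g := by
    rw [hg, le_div_iff₀ hlam0, one_mul, hlam]
    exact Real.log_le_log hq0 (by exact_mod_cast hqα)
  have hβ1 : 1 ≤ β := by
    rw [hβ, le_div_iff₀ hlam0, one_mul, hlam]
    exact Real.log_le_log hq0 (by exact_mod_cast hqv)
  have hβ2 : β ≤ 2 := by
    rw [hβ, div_le_iff₀ hlam0, hlam]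
    have := Real.log_le_log hv0 (show (v : ℝ) ≤ (q : ℝ) ^ 2 by exact_mod_cast hvq)
    rwa [Real.log_pow] at this
  have htn' : t * g ≤ n := by
    rw [hg', ← hlam, ← mul_assoc] at htn
    exact le_of_mul_le_mul_right htn hlam0
  clear hg hβ
  have hH1 : (1 : ℝ) ≤ H := by exact_mod_cast hH
  obtain ⟨L, hL⟩ : ∃ L : ℝ, L = 2 * H + 1 := ⟨_, rfl⟩
  have hL3 : 3 ≤ L := by linarith
  have ht' : 48 * (H : ℝ) ^ 2 + 98 * H + 55 ≤ t := by exact_mod_cast ht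
  obtain ⟨κ, hκ⟩ : ∃ κ : ℝ, κ = L ^ 3 * (g * β) / H ^ 2 + 2 * L * β := ⟨_, rfl⟩
  have hκ0 : 0 < κ := by rw [hκ]; positivity
  obtain ⟨K, hK⟩ : ∃ K : ℕ, K = ⌈κ⌉₊ := ⟨_, rfl⟩
  have hκK : κ ≤ K := hK ▸ Nat.le_ceil κ
  have hKκ : (K : ℝ) < κ + 1 := hK ▸ Nat.ceil_lt_add_one hκ0.le
  have hK2L : 2 * L * β ≤ K := by
    refine le_trans ?_ hκK
    rw [hκ]
    have : 0 ≤ L ^ 3 * (g * β) / H ^ 2 := by positivity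
    linarith
  have hKL2 : 2 * L ≤ K := (le_mul_of_one_le_right (by linarith) hβ1).trans hK2L
  have hK0 : (0 : ℝ) < K := by linarith
  have hKL : K * L ≤ t * g := by
    have h1 : L ^ 2 / H ≤ 4 * H + 5 := by
      rw [div_le_iff₀ (by positivity), hL]; linarith
    have h2 : L ^ 4 / H ^ 2 ≤ (4 * H + 5) ^ 2 := by
      have := pow_le_pow_left₀ (by positivity) h1 2
      rwa [div_pow, ← pow_mul] at this
    have h3 : κ * L = L ^ 4 / H ^ 2 * (g * β) + 2 * L ^ 2 * β := by rw [hκ]; ring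
    have h4 : L ^ 4 / H ^ 2 * (g * β) ≤ (4 * H + 5) ^ 2 * (g * 2) := by gcongr
    have h5 : 2 * L ^ 2 * β ≤ 2 * L ^ 2 * (g * 2) := by gcongr; linarith
    have h6 : L ≤ L * g := le_mul_of_one_le_right (by linarith) hg1
    have h7 : (K : ℝ) * L ≤ κ * L + L := by
      rw [← add_one_mul]; exact mul_le_mul_of_nonneg_right hKκ.le (by linarith)
    calc (K : ℝ) * L ≤ (2 * (4 * H + 5) ^ 2 + 4 * L ^ 2 + L) * g := by linarith
      _ ≤ t * g := by
        refine mul_le_mul_of_nonneg_right (le_trans ?_ ht') (by linarith)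
        rw [hL]; linarith
  obtain ⟨R, hR⟩ : ∃ R : ℕ, R = ⌊H * K / (L * g)⌋₊ := ⟨_, rfl⟩
  obtain ⟨S, hS⟩ : ∃ S : ℕ, S = ⌊H * K / (L * β)⌋₊ := ⟨_, rfl⟩
  have hR1 : (R : ℝ) ≤ H * K / (L * g) := hR ▸ Nat.floor_le (by positivity)
  have hS1 : (S : ℝ) ≤ H * K / (L * β) := hS ▸ Nat.floor_le (by positivity)
  have hR2 : H * K / (L * g) < R + 1 := hR ▸ Nat.lt_floor_add_one _
  have hS2 : H * K / (L * β) < S + 1 := hS ▸ Nat.lt_floor_add_one _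
  have hσ : 2 * H ≤ H * K / (L * β) := by
    rw [le_div_iff₀ (by positivity)]
    have := mul_le_mul_of_nonneg_left hK2L (by linarith : (0 : ℝ) ≤ H)
    linarith
  have hS3 : 2 * H ≤ S := by
    rw [hS]; exact Nat.le_floor (by push_cast; exact hσ)
  have hHL : (H : ℝ) / L ≤ 1 / 2 := by
    rw [div_le_div_iff₀ (by positivity) (by norm_num)]; linarith
  have hR3 : (R : ℝ) ≤ K / 2 := by
    refine hR1.trans ?_
    calc (H : ℝ) * K / (L * g) = H / L * (K / g) := by field_simp
      _ ≤ 1 / 2 * (K / 1) := by gcongr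
      _ = K / 2 := by ring
  have hS4 : (S : ℝ) ≤ K / 2 := by
    refine hS1.trans ?_
    calc (H : ℝ) * K / (L * β) = H / L * (K / β) := by field_simp
      _ ≤ 1 / 2 * (K / 1) := by gcongr
      _ = K / 2 := by ring
  have hR4 : (R : ℝ) + 1 ≤ t := by
    have h1 : (H : ℝ) * K / (L * g) ≤ t / 2 := by
      rw [div_le_iff₀ (by positivity)]
      have h1 : (H : ℝ) * K ≤ K * L / 2 := by
        have : (K : ℝ) * L = 2 * (H * K) + K := by rw [hL]; ring
        linarith
      have h2 : t * g * 1 ≤ t * g * L := by gcongr; linarith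
      linarith
    have : 0 ≤ (H : ℝ) ^ 2 := by positivity
    linarith
  have hRS : (K : ℝ) * L < (R + 1) * (S + 1 - 2 * H) := by
    have h1 : (K : ℝ) * L ≤ H * K / (L * g) * (H * K / (L * β) - 2 * H) := by
      have h2 : L ^ 3 * (g * β) / H ^ 2 ≤ K - 2 * L * β := by linarith
      calc (K : ℝ) * L = H ^ 2 * K / (L ^ 2 * (g * β)) * (L ^ 3 * (g * β) / H ^ 2) := by
            field_simp
        _ ≤ H ^ 2 * K / (L ^ 2 * (g * β)) * (K - 2 * L * β) := by gcongr
        _ = H * K / (L * g) * (H * K / (L * β) - 2 * H) := by field_simp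
    refine h1.trans_lt ?_
    have h2 : 0 < H * K / (L * g) := by positivity
    exact mul_lt_mul'' hR2 (by linarith) h2.le (by linarith)
  have hmain := interpolation_determinant_bound (H := H) (K := K) (R := R + 1) (S := S + 1)
    (by omega) hα (by omega) hu huv hn (by exact_mod_cast hK0)
    (by
      have : (K : ℝ) * L ≤ n := hKL.trans htn'
      rw [hL] at this
      exact_mod_cast this)
    (by omega) (by exact_mod_cast hR4) (by omega) (by
      obtain ⟨s, rfl⟩ := Nat.exists_eq_add_of_le hS3
      rw [show 2 * H + s + 1 - 2 * H = s + 1 by omega]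
      refine (Nat.mul_le_mul_right _ (Nat.sub_le K 1)).trans_lt ?_
      rw [hL] at hRS
      have h1 : ((2 * H + s : ℕ) : ℝ) + 1 - 2 * H = s + 1 := by push_cast; ring
      rw [h1] at hRS
      exact_mod_cast hRS)
  simp only [Nat.add_sub_cancel] at hmain
  obtain ⟨X, hX⟩ : ∃ X : ℕ, X = R + S * t := ⟨_, rfl⟩
  have ht1 : (201 : ℝ) ≤ t := by linarith [one_le_pow₀ (n := 2) hH1]
  have hX1 : 1 ≤ X := by
    have : 1 ≤ S * t := Nat.mul_pos (by omega) (by omega)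
    omega
  have hX2 : (X : ℝ) ≤ K * ((1 + t) / 2) := by
    rw [hX]; push_cast
    have := mul_le_mul_of_nonneg_right hS4 (by linarith : (0 : ℝ) ≤ t)
    linarith
  obtain ⟨P, hP0, hP1, hP2⟩ := log_prod_choose_le (K := K) hX1
  rw [← hX] at hmain
  have hXY : Real.log X - Real.log K + 2 ≤ Real.log (5 * t) := by
    have h1 := Real.log_le_log (by exact_mod_cast hX1) hX2
    rw [Real.log_mul (by positivity) (by linarith)] at h1
    have h2 : Real.log ((1 + t) / 2) + 2 ≤ Real.log (5 * t) := by
      have h4 : (1 + (t : ℝ)) / 2 * Real.exp 2 ≤ 5 * t := by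
        have := mul_le_mul_of_nonneg_left exp_two_le (by linarith : 0 ≤ (1 + (t : ℝ)) / 2)
        linarith
      have h5 := Real.log_le_log (mul_pos (by linarith) (Real.exp_pos 2)) h4
      rwa [Real.log_mul (by linarith) (Real.exp_pos 2).ne', Real.log_exp] at h5
    linarith
  have hlog : (K * L * (K * L - 1) / 2) * lam ≤ L * (K * (K - 1) / 2 * lam) +
      (K * L * Real.log (K * L) + (L * Real.log P + K * (H * (H + 1) * (R * (g * lam) + S * (β * lam))))) := by
    have h1 : (q : ℝ) ^ (∑ j ∈ Finset.range (K * (2 * H + 1)), j) ≤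
      (q ^ (∑ k ∈ Finset.range K, k)) ^ (2 * H + 1) * ((K * (2 * H + 1)).factorial *
        (P ^ (2 * H + 1) * ((α ^ R * v ^ S) ^ (H * (H + 1))) ^ K)) := by
      have h2 : (q : ℝ) ^ (∑ j ∈ Finset.range (K * (2 * H + 1)), j) ≤
        (q ^ (∑ k ∈ Finset.range K, k)) ^ (2 * H + 1) * ((K * (2 * H + 1)).factorial *
        (((∏ k ∈ Finset.range K, X.choose k : ℕ) : ℝ) ^ (2 * H + 1) *
          ((α ^ R * v ^ S) ^ (H * (H + 1))) ^ K)) := by exact_mod_cast hmain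
      refine h2.trans ?_
      gcongr
    have h3 := Real.log_le_log (by positivity) h1
    rw [Real.log_mul (by positivity) (by positivity), Real.log_mul (by positivity) (by positivity),
      Real.log_mul (by positivity) (by positivity)] at h3
    simp only [Real.log_pow] at h3
    rw [Real.log_mul (by positivity) (by positivity)] at h3
    simp only [Real.log_pow] at h3
    have h4 := log_factorial_le (K * (2 * H + 1))
    rw [sum_range_cast, sum_range_cast, ← hlam, hg', hβ'] at h3
    push_cast at h3 h4
    rw [hL]
    linarith
  have hRg : R * g ≤ H * K / L := by
    rw [le_div_iff₀ (by positivity)] at hR1 ⊢; linarith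
  have hSβ : S * β ≤ H * K / L := by
    rw [le_div_iff₀ (by positivity)] at hS1 ⊢; linarith
  obtain ⟨Y, hY⟩ : ∃ Y, Y = Real.log (5 * t) := ⟨_, rfl⟩
  rw [← hY] at hXY hHt
  rw [← hlam] at hHt
  have hW : H * (H + 1) * (R * (g * lam) + S * (β * lam)) ≤ L * (H * K * lam / 2) := by
    calc H * (H + 1) * (R * (g * lam) + S * (β * lam))
        = H * (H + 1) * lam * (R * g + S * β) := by ring
      _ ≤ H * (H + 1) * lam * (H * K / L + H * K / L) := by gcongr
      _ = (H * (H + 1) * 2 / L) * (H * K * lam) := by field_simp; ring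
      _ ≤ (L / 2) * (H * K * lam) := by
        refine mul_le_mul_of_nonneg_right ?_ (by positivity)
        rw [div_le_div_iff₀ (by positivity) (by norm_num), hL]
        linarith [sq_nonneg (H : ℝ)]
      _ = L * (H * K * lam / 2) := by ring
  have hP3 : Real.log P ≤ K * (K - 1) / 2 * (Y - 1 / 2) := by
    refine hP2.trans (mul_le_mul_of_nonneg_left (by linarith) ?_)
    have : (0 : ℝ) ≤ K - 1 := by linarith
    positivity
  have hdiv : K * H * lam ≤ Real.log (K * L) + (K - 1) / 2 * (Y - 1 / 2) + H * K * lam / 2 := by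
    have h1 : L * Real.log P ≤ L * (K * (K - 1) / 2 * (Y - 1 / 2)) := by gcongr
    have h2 := mul_le_mul_of_nonneg_left hW hK0.le
    refine le_of_mul_le_mul_left (a := K * L) ?_ (by positivity)
    have h3 : (K * L * (K * L - 1) / 2) * lam = L * (K * (K - 1) / 2 * lam) +
        K * L * (K * H * lam) := by rw [hL]; ring
    rw [h3] at hlog
    linarith
  have hlogK : Real.log (K * L) ≤ K / 4 + 5 * Real.log 2 - 2 := by
    have h1 : Real.log (K * L) ≤ Real.log (K ^ 2 / 2) :=
      Real.log_le_log (by positivity) (by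
        have := mul_le_mul_of_nonneg_left hKL2 hK0.le
        linarith)
    rw [Real.log_div (by positivity) (by norm_num), Real.log_pow] at h1
    have h2 := Real.log_le_sub_one_of_pos (x := (K : ℝ) / 8) (by positivity)
    rw [Real.log_div (by positivity) (by norm_num), show (8 : ℝ) = 2 ^ 3 by norm_num,
      Real.log_pow] at h2
    push_cast at h1 h2
    linarith
  have hY5 : 5 * Real.log 2 ≤ Y := by
    rw [hY, show (5 : ℝ) * Real.log 2 = Real.log (2 ^ 5) by rw [Real.log_pow]; norm_num]
    exact Real.log_le_log (by norm_num) (by linarith)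
  have h2 := Real.log_two_lt_d9
  have h3 : K * Y ≤ K * (H * lam) := by gcongr
  linarith

theorem exists_le_pow_of_threshold {p q t h : ℕ} (hp : 3 ≤ p) (hpq : p ≤ q)
    (hth : 48 * h ^ 2 + 98 * h + 55 ≤ t)
    (hh : 5 * (48 * (h + 1) ^ 2 + 98 * (h + 1) + 55) ≤ p ^ h) :
    ∃ H : ℕ, 1 ≤ H ∧ 5 * t ≤ q ^ H ∧ 48 * H ^ 2 + 98 * H + 55 ≤ t := by
  have hgrow : ∀ j, h ≤ j → 5 * (48 * (j + 1) ^ 2 + 98 * (j + 1) + 55) ≤ p ^ j := by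
    intro j hj
    induction j, hj using Nat.le_induction with
    | base => exact hh
    | succ j _ ih =>
      calc 5 * (48 * (j + 1 + 1) ^ 2 + 98 * (j + 1 + 1) + 55)
          ≤ 5 * (48 * (j + 1) ^ 2 + 98 * (j + 1) + 55) * 3 := by nlinarith
        _ ≤ p ^ j * p := Nat.mul_le_mul ih hp
        _ = p ^ (j + 1) := (pow_succ _ _).symm
  have hpow := Nat.le_pow_clog (b := p) (by omega) (5 * t)
  have hpos : 0 < Nat.clog p (5 * t) := Nat.clog_pos (by omega) (by omega)
  have hpred := Nat.pow_pred_clog_lt_self (b := p) (by omega) (x := 5 * t) (by omega)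
  obtain ⟨j, hj⟩ := Nat.exists_eq_succ_of_ne_zero hpos.ne'
  rw [hj] at hpow hpred
  refine ⟨j + 1, by omega, hpow.trans (Nat.pow_le_pow_left hpq _), ?_⟩
  rcases lt_or_ge j h with hjh | hjh
  · refine le_trans ?_ hth
    gcongr <;> omega
  · have := hgrow j hjh
    simp only [Nat.pred_succ, Nat.succ_eq_add_one] at hpred
    omega

theorem exists_le_pow_of_large {q t : ℕ}
    (h : (80 ≤ q ∧ 781 ≤ t) ∨ (16 ≤ q ∧ 1215 ≤ t) ∨ (3 ≤ q ∧ 5835 ≤ t)) :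
    ∃ H : ℕ, 1 ≤ H ∧ 5 * t ≤ q ^ H ∧ 48 * H ^ 2 + 98 * H + 55 ≤ t := by
  rcases h with ⟨hq, ht⟩ | ⟨hq, ht⟩ | ⟨hq, ht⟩
  · exact exists_le_pow_of_threshold (p := 80) (h := 3) (by norm_num) hq (by omega) (by norm_num)
  · exact exists_le_pow_of_threshold (p := 16) (h := 4) (by norm_num) hq (by omega) (by norm_num)
  · exact exists_le_pow_of_threshold (p := 3) (h := 10) (by norm_num) hq (by omega) (by norm_num)

/-- Run through `C, C * A, …, C * A ^ (k - 1)` modulo `Q`, and apply the test `f` to the terms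
congruent to `T` modulo `P`. -/
def scan (P T A Q o : ℕ) (f : ℕ → ℕ → Bool) (k : ℕ) : ℕ → ℕ → Bool :=
  Nat.rec (fun _ _ => true) (fun _ ih m C =>
    bif Nat.beq (C % P) T then f m C && ih (m + o) (C * A % Q) else ih (m + o) (C * A % Q)) k

/-- Lift the solutions `m` of `C ≡ T` from the modulus `P` to `P * b ^ k`, checking that all of them
exceed `M`. -/
def lift (b T M Q k : ℕ) : ℕ → ℕ → ℕ → ℕ → ℕ → Bool :=
  Nat.rec (fun _ _ _ m _ => Nat.blt M m)
    (fun _ ih P o A m C => Nat.blt M m ||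
      scan (P * b) T A Q o (ih (P * b) (o * b) (A ^ b % Q)) (min b (M / o + 1)) m C) k

/-- The least exponent `j` with `k ≤ j` and `a ^ j ≡ 1` modulo `b`, searched for among `n`
candidates, where `c = a ^ k % b`. -/
def findOrd (a b : ℕ) : ℕ → ℕ → ℕ → ℕ
  | 0, k, _ => k
  | n + 1, k, c => bif Nat.beq c 1 then k else findOrd a b n (k + 1) (c * a % b)

def pairCheck (a b : ℕ) : Bool :=
  !(Nat.beq (Nat.gcd a b) 1) ||
    (Nat.beq (a ^ findOrd a b b 1 (a % b) % b) 1 &&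
      lift b (b - a) (bif Nat.blt b 16 then 5840 * b else 1220 * b) (b ^ 10) 9 b
        (findOrd a b b 1 (a % b)) (a ^ findOrd a b b 1 (a % b) % b ^ 10) 1
        ((b - 1) * a % b ^ 10))

def rowCheck (b : ℕ) : ℕ → Bool
  | 0 => true
  | k + 1 => (Nat.blt k 2 || pairCheck k b) && rowCheck b k

def allCheck : ℕ → Bool
  | 0 => true
  | k + 1 => (Nat.blt k 3 || rowCheck k k) && allCheck k

theorem scan_spec {P T A Q o : ℕ} {f : ℕ → ℕ → Bool} (hPQ : P ∣ Q) (k : ℕ) :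
    ∀ {m C : ℕ}, scan P T A Q o f k m C = true → ∀ {i c : ℕ}, i < k →
      c ≡ C * A ^ i [MOD Q] → c % P = T → ∃ C', C' ≡ c [MOD Q] ∧ f (m + o * i) C' = true := by
  induction k with
  | zero => intro m C _ i c hi; omega
  | succ k ih =>
    intro m C h i c hi hc hT
    change (bif Nat.beq (C % P) T then f m C && scan P T A Q o f k (m + o) (C * A % Q)
      else scan P T A Q o f k (m + o) (C * A % Q)) = true at h
    rcases i with _ | i
    · rw [pow_zero, mul_one] at hc
      have h1 : Nat.beq (C % P) T = true := by
        rw [← hT]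
        exact Nat.beq_eq.mpr (hc.of_dvd hPQ).symm
      rw [h1, cond_true, Bool.and_eq_true] at h
      exact ⟨C, hc.symm, h.1⟩
    · have h1 : scan P T A Q o f k (m + o) (C * A % Q) = true := by
        cases hb : Nat.beq (C % P) T
        · rwa [hb, cond_false] at h
        · rw [hb, cond_true, Bool.and_eq_true] at h
          exact h.2
      obtain ⟨C', hC', hf⟩ := ih h1 (i := i) (c := c) (by omega) (by
        refine hc.trans ?_
        rw [pow_succ', ← mul_assoc]
        exact (Nat.mod_modEq _ _).symm.mul_right _) hT
      exact ⟨C', hC', by rwa [show m + o * (i + 1) = m + o + o * i by ring]⟩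

theorem pow_modEq_one_of_dvd {x b P : ℕ} (hb : b ∣ P) (hx : x ≡ 1 [MOD P]) :
    x ^ b ≡ 1 [MOD P * b] := by
  rw [← Int.natCast_modEq_iff] at hx ⊢
  push_cast at hx ⊢
  have h1 : (P : ℤ) ∣ x - 1 := hx.symm.dvd
  have h2 : (b : ℤ) ∣ ∑ i ∈ Finset.range b, (x : ℤ) ^ i := by
    have h3 : ∑ i ∈ Finset.range b, (x : ℤ) ^ i ≡ ∑ i ∈ Finset.range b, 1 [ZMOD b] := by
      refine Int.ModEq.sum fun i _ => ?_
      have := (hx.of_dvd (Int.natCast_dvd_natCast.mpr hb)).pow i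
      rwa [one_pow] at this
    rw [Int.modEq_iff_dvd] at h3
    simp only [Finset.sum_const, Finset.card_range, nsmul_eq_mul, mul_one] at h3
    exact (dvd_sub_right (dvd_refl _)).mp h3
  refine (Int.modEq_iff_dvd.mpr ?_).symm
  rw [← geom_sum_mul, mul_comm (∑ i ∈ Finset.range b, (x : ℤ) ^ i)]
  exact mul_dvd_mul h1 h2

theorem lift_spec {a b T M Q D : ℕ} (hb : 0 < b) (k : ℕ) : ∀ {P o A m C s : ℕ}, 0 < o →
    P * b ^ k ∣ Q → b ∣ P → T < P → A ≡ a ^ o [MOD Q] → a ^ o ≡ 1 [MOD P] →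
    C ≡ D * a ^ m [MOD Q] → m + o * s ≤ M → D * a ^ (m + o * s) ≡ T [MOD Q] →
    lift b T M Q k P o A m C = true → False := by
  induction k with
  | zero =>
    intro P o A m C s ho hPQ hbP hT hA hao hC hm hsol h
    have : Nat.blt M m = true := h
    rw [Nat.blt_eq] at this
    omega
  | succ k ih =>
    intro P o A m C s ho hPQ hbP hT hA hao hC hm hsol h
    change (Nat.blt M m || scan (P * b) T A Q o (lift b T M Q k (P * b) (o * b) (A ^ b % Q))
      (min b (M / o + 1)) m C) = true at h
    rw [Bool.or_eq_true, Nat.blt_eq] at h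
    rcases h with h | h
    · omega
    have hPQ' : P * b * b ^ k ∣ Q := by rwa [mul_assoc, ← pow_succ']
    have hPb : P * b ∣ Q := (Dvd.intro _ rfl).trans hPQ'
    have hs : b * (s / b) + s % b = s := Nat.div_add_mod s b
    have hexp : m + o * s = m + o * (s % b) + o * b * (s / b) := by
      conv_lhs => rw [← hs]
      ring
    have haob : a ^ (o * b) ≡ 1 [MOD P * b] := by
      rw [pow_mul]; exact pow_modEq_one_of_dvd hbP hao
    have hi : s % b < min b (M / o + 1) := by
      refine lt_min (Nat.mod_lt _ hb) (Nat.lt_succ_of_le ((Nat.mod_le _ _).trans ?_))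
      rw [Nat.le_div_iff_mul_le ho]
      linarith [mul_comm o s]
    obtain ⟨C', hC', hf⟩ := scan_spec hPb _ h (c := D * a ^ (m + o * (s % b))) hi
      (by
        rw [pow_add, ← mul_assoc, pow_mul]
        exact (hC.symm).mul (hA.symm.pow _))
      (by
        have h1 := hsol.of_dvd hPb
        rw [hexp, pow_add, pow_mul a (o * b), ← mul_assoc] at h1
        have h2 : D * a ^ (m + o * (s % b)) * (a ^ (o * b)) ^ (s / b) ≡
            D * a ^ (m + o * (s % b)) * 1 ^ (s / b) [MOD P * b] := (haob.pow _).mul_left _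
        rw [one_pow, mul_one] at h2
        have h3 := h2.symm.trans h1
        rw [Nat.ModEq, Nat.mod_eq_of_lt (hT.trans_le (Nat.le_mul_of_pos_right P hb))] at h3
        exact h3)
    refine ih (s := s / b) (Nat.mul_pos ho hb) hPQ' (hbP.mul_right b)
      (hT.trans_le (Nat.le_mul_of_pos_right P hb)) ?_ haob hC' (hexp ▸ hm) (hexp ▸ hsol) hf
    rw [pow_mul]
    exact (Nat.mod_modEq _ _).trans (hA.pow b)

theorem findOrd_spec {a b : ℕ} (n : ℕ) : ∀ {k c : ℕ}, c = a ^ k % b → 1 ≤ k →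
    (∀ j, 1 ≤ j → j < k → a ^ j % b ≠ 1) →
    1 ≤ findOrd a b n k c ∧ ∀ j, 1 ≤ j → j < findOrd a b n k c → a ^ j % b ≠ 1 := by
  induction n with
  | zero => intro k c _ hk h; exact ⟨hk, h⟩
  | succ n ih =>
    intro k c hc hk h
    rw [findOrd]
    cases hb : Nat.beq c 1
    · rw [cond_false]
      refine ih (by rw [pow_succ, hc, Nat.mod_mul_mod]) (by omega) fun j hj1 hj2 => ?_
      rcases Nat.lt_succ_iff_lt_or_eq.mp hj2 with hj | rfl
      · exact h j hj1 hj
      · rw [← hc]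
        exact Nat.ne_of_beq_eq_false hb
    · rw [cond_true]
      exact ⟨hk, h⟩

theorem rowCheck_spec {b : ℕ} (k : ℕ) (h : rowCheck b k = true) {a : ℕ} (ha : 2 ≤ a) (hak : a < k) :
    pairCheck a b = true := by
  induction k with
  | zero => omega
  | succ k ih =>
    rw [rowCheck, Bool.and_eq_true, Bool.or_eq_true, Nat.blt_eq] at h
    rcases Nat.lt_succ_iff_lt_or_eq.mp hak with h1 | rfl
    · exact ih h.2 h1
    · exact h.1.resolve_left (by omega)

theorem allCheck_spec (k : ℕ) (h : allCheck k = true) {a b : ℕ} (ha : 2 ≤ a) (hab : a < b)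
    (hbk : b < k) : pairCheck a b = true := by
  induction k with
  | zero => omega
  | succ k ih =>
    rw [allCheck, Bool.and_eq_true, Bool.or_eq_true, Nat.blt_eq] at h
    rcases Nat.lt_succ_iff_lt_or_eq.mp hbk with h1 | rfl
    · exact ih h.2 h1
    · exact rowCheck_spec _ (h.1.resolve_left (by omega)) ha hab

theorem pow_pred_modEq_one {a b m n : ℕ} (hab : a ≤ b) (hcop : Nat.Coprime a b)
    (hm : 1 ≤ m) (hn : n ≠ 0) (hsol : (b - 1) * a ^ m ≡ b - a [MOD b ^ n]) :
    a ^ (m - 1) ≡ 1 [MOD b] := by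
  obtain ⟨d, rfl⟩ := Nat.exists_eq_add_of_le hab
  obtain ⟨k, rfl⟩ := Nat.exists_eq_add_of_le' hm
  rw [Nat.add_sub_cancel_left] at hsol
  rw [Nat.add_sub_cancel]
  have h1 := (hsol.of_dvd (dvd_pow_self _ hn))
  have h2 : (a + d - 1) * a ^ (k + 1) + (a ^ (k + 1) + a) ≡ d + (a ^ (k + 1) + a) [MOD a + d] :=
    h1.add_right _
  rcases Nat.eq_zero_or_pos (a + d) with h0 | h0
  · obtain ⟨rfl, rfl⟩ : a = 0 ∧ d = 0 := by omega
    simp at hcop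
  have h3 : (a + d - 1) * a ^ (k + 1) + (a ^ (k + 1) + a) = (a + d) * a ^ (k + 1) + a := by
    obtain ⟨e, he⟩ := Nat.exists_eq_succ_of_ne_zero h0.ne'
    rw [he, Nat.succ_sub_one, Nat.succ_eq_add_one]
    ring
  have h4 : d + (a ^ (k + 1) + a) = (a + d) * 1 + a * a ^ k := by ring
  rw [h3, h4] at h2
  have h5 : a * 1 ≡ a * a ^ k [MOD a + d] := by
    simpa [Nat.ModEq, Nat.mul_add_mod] using h2
  exact (Nat.ModEq.cancel_left_of_coprime (by rwa [Nat.gcd_comm]) h5).symm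

theorem lt_of_pairCheck {a b m : ℕ} (ha : 2 ≤ a) (hab : a < b) (hcop : Nat.Coprime a b)
    (hm : 1 ≤ m) (hsol : (b - 1) * a ^ m ≡ b - a [MOD b ^ 10]) (h : pairCheck a b = true) :
    (if b < 16 then 5840 * b else 1220 * b) < m := by
  by_contra! hle
  rw [pairCheck, Bool.or_eq_true, Bool.and_eq_true] at h
  rcases h with h | ⟨h1, h2⟩
  · rw [hcop] at h
    exact absurd h (by decide)
  obtain ⟨hg0, hg⟩ := findOrd_spec (a := a) (b := b) b (k := 1) (c := a % b) (by rw [pow_one])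
    le_rfl (by omega)
  set g := findOrd a b b 1 (a % b)
  have hb1 : 1 % b = 1 := Nat.mod_eq_of_lt (by omega)
  have hag : a ^ g ≡ 1 [MOD b] := by rw [Nat.ModEq, hb1]; exact Nat.eq_of_beq_eq_true h1
  have hm1 : a ^ (m - 1) ≡ 1 [MOD b] := pow_pred_modEq_one hab.le hcop hm (by norm_num) hsol
  have hdvd : g ∣ m - 1 := by
    by_contra hnd
    have hr : 0 < (m - 1) % g := Nat.pos_of_ne_zero fun h0 => hnd (Nat.dvd_of_mod_eq_zero h0)
    refine hg _ hr (Nat.mod_lt _ hg0) ?_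
    have h3 : a ^ (m - 1) ≡ a ^ ((m - 1) % g) [MOD b] := by
      conv_lhs => rw [← Nat.div_add_mod (m - 1) g, pow_add, pow_mul]
      have := ((hag.pow ((m - 1) / g)).mul_right (a ^ ((m - 1) % g)))
      rwa [one_pow, one_mul] at this
    have h4 := h3.symm.trans hm1
    rwa [Nat.ModEq, hb1] at h4
  obtain ⟨s, hs⟩ := hdvd
  have hms : m = 1 + g * s := by omega
  refine lift_spec (a := a) (D := b - 1) (s := s) (by omega) 9 hg0 (by rw [← pow_succ'])
    dvd_rfl (by omega) (Nat.mod_modEq _ _) hag ?_ ?_ (hms ▸ hsol) h2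
  · rw [pow_one]; exact Nat.mod_modEq _ _
  · rw [← hms]
    refine hle.trans_eq ?_
    by_cases hb : b < 16
    · rw [if_pos hb, (Nat.blt_eq).mpr hb, cond_true]
    · rw [if_neg hb, Bool.eq_false_iff.mpr (fun h => hb (Nat.blt_eq.mp h)), cond_false]

set_option maxRecDepth 100000 in
theorem allCheck_eighty : allCheck 80 = true := by decide +kernel

theorem IsNSol.mul_add_one {N x m : ℕ} (h : IsNSol N x m) : N * (x - 1) + 1 = x ^ m := by
  rw [← h.2.2]
  have := Nat.geomSum_eq h.1 m
  have h1 : x - 1 ∣ x ^ m - 1 := by simpa using Nat.sub_dvd_pow_sub_pow x 1 m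
  rw [this, Nat.div_mul_cancel h1]
  have : 0 < x ^ m := Nat.pow_pos (by linarith [h.1])
  omega

theorem IsNSol.lt_pow {N x m : ℕ} (h : IsNSol N x m) : N < x ^ m := by
  have h1 := h.mul_add_one
  have : N * 1 ≤ N * (x - 1) := Nat.mul_le_mul_left _ (by have := h.1; omega)
  omega

theorem IsNSol.log_lt {N x m : ℕ} (hN : 2 ≤ N) (h : IsNSol N x m) :
    Real.log N < m * Real.log x := by
  rw [← Real.log_pow]
  exact Real.log_lt_log (by exact_mod_cast (by omega : 0 < N)) (by exact_mod_cast h.lt_pow)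

theorem IsNSol.pow_pred_le {N x m : ℕ} (h : IsNSol N x m) : x ^ (m - 1) ≤ N := by
  rw [← h.2.2]
  exact Finset.single_le_sum (f := fun i => x ^ i) (fun _ _ => Nat.zero_le _)
    (Finset.mem_range.mpr (by have := h.2.1; omega))

theorem IsNSol.lt_of_lt {N a m b n : ℕ} (h₁ : IsNSol N a m) (h₂ : IsNSol N b n) (hab : a < b) :
    n < m := by
  by_contra! hmn
  have h1 : ∑ i ∈ Finset.range m, a ^ i < ∑ i ∈ Finset.range m, b ^ i :=
    Finset.sum_lt_sum (fun i _ => Nat.pow_le_pow_left hab.le i)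
      ⟨1, Finset.mem_range.mpr h₁.2.1, by simpa using hab⟩
  have h2 : ∑ i ∈ Finset.range m, b ^ i ≤ ∑ i ∈ Finset.range n, b ^ i :=
    Finset.sum_le_sum_of_subset (Finset.range_mono hmn)
  have h3 := h₁.2.2
  have h4 := h₂.2.2
  omega

/-- The exponential equation satisfied by two solutions. -/
theorem IsNSol.mul_pow_add {N a m b n : ℕ} (h₁ : IsNSol N a m) (h₂ : IsNSol N b n) (hab : a < b) :
    (b - 1) * a ^ m = (a - 1) * b ^ n + (b - a) := by
  rw [← h₁.mul_add_one, ← h₂.mul_add_one]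
  obtain ⟨a, rfl⟩ := Nat.exists_eq_add_of_le' (show 1 ≤ a by linarith [h₁.1])
  obtain ⟨d, rfl⟩ := Nat.exists_eq_add_of_le hab.le
  rw [Nat.add_sub_cancel_left, Nat.add_sub_cancel, show a + 1 + d - 1 = a + d by omega]
  ring

theorem coprime_of_mul_pow_add {a b m n : ℕ} (hab : a < b) (hmn : n ≤ m) (hbn : b ≤ 2 ^ n)
    (h : (b - 1) * a ^ m = (a - 1) * b ^ n + (b - a)) : Nat.Coprime a b := by
  by_contra hg
  have h1 : Nat.gcd a b ^ n ∣ b - a := by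
    refine (Nat.dvd_add_right (b := (a - 1) * b ^ n) ?_).mp ?_
    · exact (pow_dvd_pow_of_dvd (Nat.gcd_dvd_right a b) n).mul_left _
    · rw [← h]
      exact ((pow_dvd_pow_of_dvd (Nat.gcd_dvd_left a b) n).trans (pow_dvd_pow a hmn)).mul_left _
  have h2 := Nat.le_of_dvd (by omega) h1
  have h3 : Nat.gcd a b ≠ 0 := fun h0 => by rw [Nat.gcd_eq_zero_iff] at h0; omega
  have h4 : 2 ^ n ≤ Nat.gcd a b ^ n := Nat.pow_le_pow_left (by
    have : Nat.gcd a b ≠ 1 := hg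
    omega) n
  have h5 : a ≠ 0 := by
    rintro rfl
    rcases Nat.eq_zero_or_pos m with rfl | hm
    · obtain rfl : n = 0 := by omega
      simp at hbn
      omega
    · rw [zero_pow (by omega)] at h
      omega
  omega

theorem IsNSol.quotient_lt_threshold {N a m b n g : ℕ} (h₁ : IsNSol N a m) (h₂ : IsNSol N b n)
    (hab : a < b) (hg : 0 < g) (hag : a ^ g ≡ 1 [MOD b]) {t : ℕ} (ht : m - 1 = g * t) :
    ¬ ((80 ≤ b ∧ 781 ≤ t) ∨ (16 ≤ b ∧ 1215 ≤ t) ∨ (3 ≤ b ∧ 5835 ≤ t)) := by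
  intro hbt
  have ha2 := h₁.1
  obtain ⟨H, hH1, hHt, ht'⟩ := exists_le_pow_of_large hbt
  have hα1 : 1 < a ^ g := Nat.one_lt_pow hg.ne' (by omega)
  have hm : m = g * t + 1 := by have := h₁.2.1; omega
  refine not_dvd_sub_mul_pow (q := b) (α := a ^ g) (u := b - a) (v := a * (b - 1)) (t := t) (n := n)
    (H := H) (by omega) ?_ ?_ (by omega) ?_ ?_ ?_ ?_ hH1 ?_ ht' ?_
  · exact_mod_cast (Int.natCast_modEq_iff.mpr hag).symm.dvd
  · have := (Nat.modEq_iff_dvd' hα1.le).mp hag.symm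
    have := Nat.le_of_dvd (by omega) this
    omega
  · calc b - a < 2 * (b - 1) := by omega
      _ ≤ a * (b - 1) := Nat.mul_le_mul_right _ ha2
  · calc b ≤ 2 * (b - 1) := by omega
      _ ≤ a * (b - 1) := Nat.mul_le_mul_right _ ha2
  · rw [sq]; exact Nat.mul_le_mul hab.le (Nat.sub_le b 1)
  · rw [Nat.cast_pow, ← Real.log_pow, ← Real.log_pow, ← pow_mul, ← ht]
    refine Real.log_le_log (by positivity) ?_
    exact_mod_cast h₁.pow_pred_le.trans h₂.lt_pow.le
  · rw [← Real.log_pow]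
    exact Real.log_le_log (by have : 0 < t := by omega
                              positivity) (by exact_mod_cast hHt)
  · refine ⟨-((a : ℤ) - 1), ?_⟩
    have h := h₁.mul_pow_add h₂ hab
    rw [hm, pow_succ, pow_mul] at h
    zify [hab.le, (by omega : 1 ≤ a), (by omega : 1 ≤ b)] at h ⊢
    linear_combination -h

theorem log_le_of_pos {x c : ℝ} (hx : 0 < x) (hc : 0 < c) : Real.log x ≤ x / c + Real.log c - 1 := by
  have := Real.log_le_sub_one_of_pos (x := x / c) (by positivity)
  rw [Real.log_div hx.ne' hc.ne'] at this
  linarith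

theorem stmt12 (N x₁ m₁ x₂ m₂ : ℕ) (hN : 2 ≤ N)
    (h₁ : IsNSol N x₁ m₁) (h₂ : IsNSol N x₂ m₂) (hx : x₁ < x₂) :
    Real.log N ^ (0.33479 : ℝ) < (x₂ : ℝ) := by
  by_contra! hcon
  have hmn := h₁.lt_of_lt h₂ hx
  have heq := h₁.mul_pow_add h₂ hx
  have ha2 := h₁.1
  have hb3 : (3 : ℝ) ≤ x₂ := by exact_mod_cast (by omega : 3 ≤ x₂)
  have hb0 : (0 : ℝ) < x₂ := by linarith
  have hlN0 : 0 < Real.log N := Real.log_pos (by exact_mod_cast (by omega : 1 < N))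
  have hpow : (x₂ : ℝ) ^ (2.9 : ℝ) ≤ Real.log N := by
    have h1 : 1 ≤ Real.log N := by
      by_contra! h
      have := Real.rpow_le_one hlN0.le h.le (by norm_num : (0 : ℝ) ≤ 0.33479)
      linarith
    calc (x₂ : ℝ) ^ (2.9 : ℝ) ≤ (Real.log N ^ (0.33479 : ℝ)) ^ (2.9 : ℝ) :=
          Real.rpow_le_rpow hb0.le hcon (by norm_num)
      _ = Real.log N ^ (0.33479 * 2.9 : ℝ) := (Real.rpow_mul hlN0.le _ _).symm
      _ ≤ Real.log N ^ (1 : ℝ) := Real.rpow_le_rpow_of_exponent_le h1 (by norm_num)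
      _ = Real.log N := Real.rpow_one _
  have hlogb : Real.log x₂ ≤ 0.37 * x₂ := by
    have h1 := log_le_of_pos hb0 (Real.exp_pos 1)
    rw [Real.log_exp] at h1
    have h2 : (x₂ : ℝ) / Real.exp 1 ≤ 0.37 * x₂ := by
      rw [div_le_iff₀ (Real.exp_pos 1)]
      have := Real.exp_one_gt_d9
      nlinarith
    linarith
  have hsplit : (x₂ : ℝ) ^ (2.9 : ℝ) = x₂ ^ 2 * (x₂ : ℝ) ^ (0.9 : ℝ) := by
    rw [← Real.rpow_natCast, ← Real.rpow_add hb0]; norm_num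
  have hnlog := h₂.log_lt hN
  have hn4b : 4 * (x₂ : ℝ) < m₂ := by
    have h1 : (1.7 : ℝ) ≤ (x₂ : ℝ) ^ (0.9 : ℝ) := by
      calc (1.7 : ℝ) ≤ √x₂ := Real.le_sqrt_of_sq_le (by linarith)
        _ = (x₂ : ℝ) ^ (1 / 2 : ℝ) := Real.sqrt_eq_rpow _
        _ ≤ (x₂ : ℝ) ^ (0.9 : ℝ) :=
          Real.rpow_le_rpow_of_exponent_le (by linarith) (by norm_num)
    have h2 : (x₂ : ℝ) ^ 2 * 1.7 ≤ x₂ ^ 2 * (x₂ : ℝ) ^ (0.9 : ℝ) := by gcongr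
    have h3 : (m₂ : ℝ) * Real.log x₂ ≤ m₂ * (0.37 * x₂) := by gcongr
    refine lt_of_mul_lt_mul_left (a := 0.37 * (x₂ : ℝ)) ?_ (by positivity)
    have h4 : 0 < (x₂ : ℝ) ^ 2 := by positivity
    linarith
  have hn4b' : 4 * x₂ < m₂ := by exact_mod_cast hn4b
  have hn10 : 10 ≤ m₂ := by omega
  have hnb : x₂ ≤ 2 ^ m₂ := by
    have := Nat.lt_two_pow_self (n := m₂)
    omega
  have hcop := coprime_of_mul_pow_add hx hmn.le hnb heq
  have hsol : (x₂ - 1) * x₁ ^ m₁ ≡ x₂ - x₁ [MOD x₂ ^ m₂] := by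
    rw [heq, Nat.ModEq, Nat.mul_add_mod']
  have hm1 := pow_pred_modEq_one hx.le hcop (by omega) (by omega) hsol
  obtain ⟨g, hg⟩ : ∃ g, g = orderOf (ZMod.unitOfCoprime x₁ hcop) := ⟨_, rfl⟩
  have hiff : ∀ k, x₁ ^ k ≡ 1 [MOD x₂] ↔ g ∣ k := fun k => by
    rw [hg, orderOf_dvd_iff_pow_eq_one, ← ZMod.natCast_eq_natCast_iff, Units.ext_iff]
    simp
  have : NeZero x₂ := ⟨by omega⟩
  have : Fact (1 < x₂) := ⟨by omega⟩
  have hg0 : 0 < g := hg ▸ orderOf_pos _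
  have hgb : g ≤ x₂ - 1 := by
    have h1 : g ≤ Nat.totient x₂ := by
      rw [hg, ← ZMod.card_units_eq_totient]
      exact orderOf_le_card_univ
    have := Nat.totient_lt x₂ (by omega)
    omega
  obtain ⟨t, ht⟩ := (hiff _).mp hm1
  have htb := h₁.quotient_lt_threshold h₂ hx hg0 ((hiff g).mpr dvd_rfl) ht
  have hm_le : ∀ c, t ≤ c → m₁ ≤ (x₂ - 1) * c + 1 := fun c hc => by
    have : g * t ≤ (x₂ - 1) * c := Nat.mul_le_mul hgb hc
    omega
  rcases lt_or_ge x₂ 80 with hb80 | hb80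
  · have h1 := lt_of_pairCheck ha2 hx hcop (by omega) (hsol.of_dvd (pow_dvd_pow _ hn10))
      (allCheck_spec 80 allCheck_eighty ha2 hx hb80)
    split_ifs at h1 with hb16
    · have := hm_le 5834 (by omega)
      omega
    · have := hm_le 1214 (by omega)
      omega
  · have h1 := hm_le 780 (by omega)
    have hmb : (m₁ : ℝ) ≤ 780 * x₂ := by exact_mod_cast (by omega : m₁ ≤ 780 * x₂)
    have hb80' : (80 : ℝ) ≤ x₂ := by exact_mod_cast hb80
    have hlogb2 : Real.log x₂ ≤ 0.056 * x₂ := by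
      have h2 := log_le_of_pos hb0 (show (0 : ℝ) < 128 by norm_num)
      rw [show (128 : ℝ) = 2 ^ 7 by norm_num, Real.log_pow] at h2
      have := Real.log_two_lt_d9
      push_cast at h2
      linarith
    have h2 : Real.log x₁ ≤ Real.log x₂ :=
      Real.log_le_log (by exact_mod_cast (by omega : 0 < x₁)) (by exact_mod_cast hx.le)
    have h3 := h₁.log_lt hN
    have h4 : (m₁ : ℝ) * Real.log x₁ ≤ 780 * x₂ * (0.056 * x₂) :=
      mul_le_mul hmb (h2.trans hlogb2) (Real.log_natCast_nonneg _) (by positivity)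
    have h5 : (50 : ℝ) ≤ (x₂ : ℝ) ^ (0.9 : ℝ) := by
      refine le_trans ?_ (Real.rpow_le_rpow (by norm_num) hb80' (by norm_num))
      refine le_of_pow_le_pow_left₀ (n := 10) (by norm_num) (by positivity) ?_
      rw [← Real.rpow_natCast, ← Real.rpow_natCast, ← Real.rpow_mul (by norm_num)]
      norm_num
    have h6 : (x₂ : ℝ) ^ 2 * 50 ≤ x₂ ^ 2 * (x₂ : ℝ) ^ (0.9 : ℝ) := by gcongr
    nlinarith
end

section
/- Let N ≥ 2 be an integer and suppose (x_1, m_1) and (x_2, m_2) are two N-solutions with x_1 < x_2. Put Λ = m_1·log x_1 − m_2·log x_2 − log((x_1 − 1)/(x_2 − 1)). Then Λ = log(x_1^{m_1}/(x_1^{m_1} − 1)) − log(x_2^{m_2}/(x_2^{m_2} − 1)) and 0 < Λ < 1/(x_1^{m_1} − 1). -/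
theorem IsNSol.pow_sub_one_eq {N x m : ℕ} (h : IsNSol N x m) :
    (x : ℝ) ^ m - 1 = N * ((x : ℝ) - 1) := by
  rw [← geom_sum_mul, ← h.2.2]
  push_cast
  rfl

theorem stmt14 (N x₁ m₁ x₂ m₂ : ℕ) (hN : 2 ≤ N)
    (h₁ : IsNSol N x₁ m₁) (h₂ : IsNSol N x₂ m₂) (hx : x₁ < x₂)
    (Λ : ℝ)
    (hΛ : Λ = (m₁ : ℝ) * Real.log x₁ - (m₂ : ℝ) * Real.log x₂
        - Real.log (((x₁ : ℝ) - 1) / ((x₂ : ℝ) - 1))) :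
    Λ = Real.log ((x₁ : ℝ) ^ m₁ / ((x₁ : ℝ) ^ m₁ - 1))
        - Real.log ((x₂ : ℝ) ^ m₂ / ((x₂ : ℝ) ^ m₂ - 1)) ∧
    0 < Λ ∧ Λ < 1 / ((x₁ : ℝ) ^ m₁ - 1) := by
  have hx₁ : (2 : ℝ) ≤ x₁ := by exact_mod_cast h₁.1
  have hx₁₂ : (x₁ : ℝ) < x₂ := by exact_mod_cast hx
  have hN0 : (0 : ℝ) < N := by exact_mod_cast (by omega : 0 < N)
  have e₁ := h₁.pow_sub_one_eq
  have e₂ := h₂.pow_sub_one_eq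
  have hu : (0 : ℝ) < x₁ - 1 := by linarith
  have hv : (0 : ℝ) < x₂ - 1 := by linarith
  have hA : 0 < (x₁ : ℝ) ^ m₁ - 1 := e₁ ▸ mul_pos hN0 hu
  have hAB : (x₁ : ℝ) ^ m₁ - 1 < (x₂ : ℝ) ^ m₂ - 1 := by
    rw [e₁, e₂]
    gcongr
  have hB := hA.trans hAB
  have key : Λ = Real.log ((x₁ : ℝ) ^ m₁ / ((x₁ : ℝ) ^ m₁ - 1))
      - Real.log ((x₂ : ℝ) ^ m₂ / ((x₂ : ℝ) ^ m₂ - 1)) := by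
    rw [hΛ, Real.log_div (by linarith) hA.ne', Real.log_div (by linarith) hB.ne', e₁, e₂,
      Real.log_mul hN0.ne' hu.ne', Real.log_mul hN0.ne' hv.ne', Real.log_div hu.ne' hv.ne',
      Real.log_pow, Real.log_pow]
    ring
  refine ⟨key, ?_⟩
  have one_add : ∀ t : ℝ, 0 < t - 1 → t / (t - 1) = 1 + 1 / (t - 1) := by
    intro t ht
    field_simp
    ring
  rw [key, one_add _ hA, one_add _ hB]
  have pA := one_div_pos.mpr hA
  have pB := one_div_pos.mpr hB
  constructor
  · have := one_div_lt_one_div_of_lt hA hAB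
    exact sub_pos.mpr (Real.log_lt_log (by linarith) (by linarith))
  · have hlog := Real.log_le_sub_one_of_pos
      (show 0 < 1 + 1 / ((x₁ : ℝ) ^ m₁ - 1) by linarith)
    have hpos := Real.log_pos (show 1 < 1 + 1 / ((x₂ : ℝ) ^ m₂ - 1) by linarith)
    linarith
end
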